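/- Let q be odd and F/K a dihedral extension of degree 2q of number fields, with L and k the subfields fixed by the rotation subgroup and an order-2 subgroup respectively. Then the class numbers satisfy h_F = h_L · (h_k/h_K)² · (R_k² R_L)/(R_K² R_F), where R_M denotes the regulator of M; in particular (R_k² R_L)/(R_K² R_F) is rational. -/

import Mathlib

open NumberField NumberField.Units

/-- The sum of `f` over the automorphisms of `F` fixing `M`. -/
noncomputable def galSum (M F : Type*) [Field M] [Field F] [Algebra M F] [FiniteDimensional M F]
    (f : (F ≃+* F) → ℝ) : ℝ :=
  ∑ σ : F ≃ₐ[M] F, f σ.toRingEquiv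

theorem galSum_self (F : Type*) [Field F] (f : (F ≃+* F) → ℝ) : galSum F F f = f 1 := by
  rw [galSum, Fintype.sum_eq_single 1]
  · rfl
  · exact fun σ hσ ↦ (hσ (AlgEquiv.ext fun x ↦ σ.commutes x)).elim

theorem galSum_eq_sum_equiv {K F : Type*} [Field K] [Field F] [Algebra K F]
    [FiniteDimensional K F] {G : Type*} [Group G] [Fintype G] (e : (F ≃ₐ[K] F) ≃* G)
    (f : (F ≃+* F) → ℝ) :
    galSum K F f = ∑ g, f (e.symm g).toRingEquiv :=
  Fintype.sum_equiv e.toEquiv _ _ fun σ ↦ by simp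

theorem galSum_fixedField {K F : Type*} [Field K] [Field F] [Algebra K F]
    [FiniteDimensional K F] {G : Type*} [Group G] [Fintype G] (e : (F ≃ₐ[K] F) ≃* G)
    (H : Subgroup G) [Fintype H] (M : IntermediateField K F)
    (hM : M = IntermediateField.fixedField (H.comap e.toMonoidHom)) (f : (F ≃+* F) → ℝ) :
    galSum M F f = ∑ h : H, f (e.symm h).toRingEquiv := by
  have hfix : M.fixingSubgroup = H.comap e.toMonoidHom := by
    rw [hM, IntermediateField.fixingSubgroup_fixedField]
  symm
  refine Fintype.sum_bijective
    (fun h : H ↦ M.fixingSubgroupEquiv ⟨e.symm h, by rw [hfix]; simp⟩) ?_ _ _ ?_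
  · refine (M.fixingSubgroupEquiv.bijective).comp ⟨fun a b hab ↦ ?_, fun σ ↦ ?_⟩
    · simpa using hab
    · refine ⟨⟨e σ, ?_⟩, ?_⟩
      · simpa using hfix.le σ.2
      · simp
  · intro h
    congr 1

namespace DihedralGroup

theorem mem_zpowers_r_iff {q : ℕ} [NeZero q] (g : DihedralGroup q) :
    g ∈ Subgroup.zpowers (r (1 : ZMod q)) ↔ ∃ i, g = r i := by
  rw [Subgroup.mem_zpowers_iff]
  refine ⟨fun ⟨k, hk⟩ ↦ ⟨k, by rw [← hk, r_one_zpow]⟩, ?_⟩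
  rintro ⟨i, rfl⟩
  exact ⟨i.val, by simp⟩

theorem mem_zpowers_sr_iff {q : ℕ} (g : DihedralGroup q) (i : ZMod q) :
    g ∈ Subgroup.zpowers (sr i) ↔ g = 1 ∨ g = sr i := by
  rw [Subgroup.mem_zpowers_iff]
  constructor
  · rintro ⟨k, rfl⟩
    rw [← zpow_mod_orderOf, orderOf_sr]
    obtain h | h := Int.emod_two_eq_zero_or_one k <;> simp [h]
  · rintro (rfl | rfl)
    · exact ⟨0, zpow_zero _⟩
    · exact ⟨1, zpow_one _⟩

theorem sum_eq_sum_r_add_sum_sr {q : ℕ} [NeZero q] {M : Type*} [AddCommMonoid M]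
    (f : DihedralGroup q → M) :
    ∑ g, f g = ∑ i : ZMod q, f (r i) + ∑ i : ZMod q, f (sr i) := by
  rw [← equivSum.symm.sum_comp, Fintype.sum_sum_type]
  rfl

theorem sum_zpowers_r {q : ℕ} [NeZero q] {M : Type*} [AddCommMonoid M]
    [Fintype (Subgroup.zpowers (r (1 : ZMod q)))] (f : DihedralGroup q → M) :
    ∑ g : Subgroup.zpowers (r (1 : ZMod q)), f g = ∑ i : ZMod q, f (r i) := by
  symm
  refine Fintype.sum_bijective
    (fun i ↦ (⟨r i, (mem_zpowers_r_iff _).2 ⟨i, rfl⟩⟩ : Subgroup.zpowers (r (1 : ZMod q))))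
    ⟨fun i j h ↦ ?_, fun g ↦ ?_⟩ _ _ fun i ↦ rfl
  · simpa using h
  · obtain ⟨i, hi⟩ := (mem_zpowers_r_iff _).1 g.2
    exact ⟨i, Subtype.ext hi.symm⟩

theorem sum_zpowers_sr {q : ℕ} {M : Type*} [AddCommMonoid M] (i : ZMod q)
    [Fintype (Subgroup.zpowers (sr i))] (f : DihedralGroup q → M) :
    ∑ g : Subgroup.zpowers (sr i), f g = f 1 + f (sr i) := by
  classical
  have h : (1 : DihedralGroup q) ≠ sr i := by rw [one_def]; exact fun h ↦ by cases h
  rw [← Finset.sum_pair h]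
  exact (Finset.sum_subtype _ (fun g ↦ by simp [mem_zpowers_sr_iff]) f).symm

theorem isConj_sr {q : ℕ} (hq : Odd q) (i : ZMod q) : ∃ g, g * sr 0 * g⁻¹ = sr i := by
  obtain ⟨m, rfl⟩ := hq
  refine ⟨r (m * i), ?_⟩
  have h : (2 * m + 1 : ZMod (2 * m + 1)) = 0 := by
    exact_mod_cast ZMod.natCast_self (2 * m + 1)
  simp only [r_mul_sr, inv_r, sr_mul_r]
  congr 1
  linear_combination -i * h

end DihedralGroup

section
open DihedralGroup

variable {q : ℕ} [NeZero q] (hq : Odd q)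
    {K F : Type*} [Field K] [Field F] [Algebra K F] [FiniteDimensional K F] [IsGalois K F]
    (e : (F ≃ₐ[K] F) ≃* DihedralGroup q) (L k : IntermediateField K F)
    (hL : L = IntermediateField.fixedField
      ((Subgroup.zpowers (DihedralGroup.r (1 : ZMod q))).comap e.toMonoidHom))
    (hk : k = IntermediateField.fixedField
      ((Subgroup.zpowers (DihedralGroup.sr (0 : ZMod q))).comap e.toMonoidHom))

theorem finrank_eq_galSum_one (M F : Type*) [Field M] [Field F] [Algebra M F]
    [FiniteDimensional M F] [IsGalois M F] : (Module.finrank M F : ℝ) = galSum M F 1 := by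
  rw [← IsGalois.card_aut_eq_finrank, Nat.card_eq_fintype_card]
  simp [galSum]

include hq hL hk in
theorem dihedral_relation
    {f : (F ≃+* F) → ℝ} (hf : ∀ σ τ, f (τ * σ * τ⁻¹) = f σ) {nF nK nL nk : ℝ}
    (hnF : Module.finrank F F * nF = galSum F F f)
    (hnK : Module.finrank K F * nK = galSum K F f)
    (hnL : Module.finrank L F * nL = galSum L F f)
    (hnk : Module.finrank k F * nk = galSum k F f) :
    nF + 2 * nK = nL + 2 * nk := by
  classical
  have h0 : (q : ℝ) ≠ 0 := NeZero.ne _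
  have hsr (i : ZMod q) : f (e.symm (sr i)).toRingEquiv = f (e.symm (sr 0)).toRingEquiv := by
    obtain ⟨g, hg⟩ := isConj_sr hq i
    rw [← hg, ← hf (e.symm (sr 0)).toRingEquiv (e.symm g).toRingEquiv, map_mul, map_mul, map_inv]
    rfl
  have h1 : (1 : F ≃ₐ[K] F).toRingEquiv = 1 := rfl
  rw [finrank_eq_galSum_one, galSum_self, galSum_self] at hnF
  rw [finrank_eq_galSum_one, galSum_eq_sum_equiv e, galSum_eq_sum_equiv e,
    sum_eq_sum_r_add_sum_sr, sum_eq_sum_r_add_sum_sr] at hnK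
  rw [finrank_eq_galSum_one, galSum_fixedField e _ L hL, galSum_fixedField e _ L hL,
    sum_zpowers_r (fun g ↦ f (e.symm g).toRingEquiv),
    sum_zpowers_r (fun g ↦ (1 : (F ≃+* F) → ℝ) (e.symm g).toRingEquiv)] at hnL
  rw [finrank_eq_galSum_one, galSum_fixedField e _ k hk, galSum_fixedField e _ k hk,
    sum_zpowers_sr 0 (fun g ↦ f (e.symm g).toRingEquiv),
    sum_zpowers_sr 0 (fun g ↦ (1 : (F ≃+* F) → ℝ) (e.symm g).toRingEquiv)] at hnk
  simp [hsr, h1] at hnF hnK hnL hnk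
  have : (q : ℝ) * (nF + 2 * nK) = q * (nL + 2 * nk) := by
    rw [hnF]
    linear_combination hnK - hnL - q * hnk
  exact mul_left_cancel₀ h0 this
end

section
variable {G A B Ω : Type*} [Group G] [CommRing A] [CommRing B] [Algebra A B]
  [MulSemiringAction G B]

theorem RingHom.comp_toRingHom_mul [CommRing Ω] (y : B →+* Ω) (g h : G) :
    y.comp (MulSemiringAction.toRingHom G B (g * h)) =
      (y.comp (MulSemiringAction.toRingHom G B g)).comp (MulSemiringAction.toRingHom G B h) := by
  ext b
  simp [mul_smul]

open Polynomial in
/-- Two homomorphisms to a domain agreeing on the fixed subring differ by a group element. -/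
theorem RingHom.exists_eq_comp_toRingHom [_root_.Finite G] [CommRing Ω] [IsDomain Ω]
    [Algebra.IsInvariant A B G] {y z : B →+* Ω}
    (h : y.comp (algebraMap A B) = z.comp (algebraMap A B)) :
    ∃ g : G, z = y.comp (MulSemiringAction.toRingHom G B g) := by
  classical
  cases nonempty_fintype G
  by_contra! H
  have H' (g : G) : ∃ b, z b ≠ y (g • b) := by
    by_contra! H'
    exact H g (RingHom.ext H')
  choose b hb using H'
  let c : B[X] := ∑ g, monomial (Fintype.equivFin G g : ℕ) (b g)
  have hc (g : G) : c.coeff (Fintype.equivFin G g : ℕ) = b g := by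
    simp [c, coeff_monomial, Fin.val_inj]
  have hy : mapRingHom (mapRingHom y) (MulSemiringAction.charpoly G c) =
      mapRingHom (mapRingHom z) (MulSemiringAction.charpoly G c) := by
    ext m n
    simp only [coe_mapRingHom, coeff_map]
    obtain ⟨a, ha⟩ := Algebra.IsInvariant.isInvariant (A := A) (G := G)
      (((MulSemiringAction.charpoly G c).coeff m).coeff n) fun g ↦ by
        rw [← coeff_smul, MulSemiringAction.smul_coeff_charpoly]
    rw [← ha]
    exact RingHom.congr_fun h a
  have h0 : (mapRingHom (mapRingHom y) (MulSemiringAction.charpoly G c)).eval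
      (c.map z) = 0 := by
    rw [hy, coe_mapRingHom, ← coe_mapRingHom, eval_map, coe_mapRingHom]
    have := eval₂_hom (p := MulSemiringAction.charpoly G c) (mapRingHom z) c
    rw [coe_mapRingHom] at this
    rw [this, MulSemiringAction.eval_charpoly, Polynomial.map_zero]
  rw [MulSemiringAction.charpoly_eq, map_prod, eval_prod, Finset.prod_eq_zero_iff] at h0
  obtain ⟨g, -, hg⟩ := h0
  have := congr_arg (coeff · (Fintype.equivFin G g : ℕ)) hg
  simp [hc, sub_eq_zero] at this
  exact hb g this

theorem RingHom.exists_comp_algebraMap_eq [Field Ω] [IsAlgClosed Ω] [Algebra.IsIntegral A B]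
    [FaithfulSMul A B] (z : A →+* Ω) : ∃ y : B →+* Ω, y.comp (algebraMap A B) = z := by
  have : (RingHom.ker z).IsPrime := RingHom.ker_isPrime z
  obtain ⟨Q, hQ, hQz⟩ := (inferInstance : Nonempty (Ideal.primesOver (RingHom.ker z) B))
  let : Algebra (A ⧸ RingHom.ker z) Ω := (RingHom.kerLift z).toAlgebra
  have : FaithfulSMul (A ⧸ RingHom.ker z) Ω :=
    (faithfulSMul_iff_algebraMap_injective _ _).2 (RingHom.kerLift_injective z)
  have : FaithfulSMul (A ⧸ RingHom.ker z) (B ⧸ Q) :=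
    Ideal.Quotient.instFaithfulSMul Q _
  have : Module.IsTorsionFree (A ⧸ RingHom.ker z) (B ⧸ Q) :=
    Module.isTorsionFree_iff_faithfulSMul.2 this
  let f : B ⧸ Q →ₐ[A ⧸ RingHom.ker z] Ω := IsAlgClosed.lift
  refine ⟨f.toRingHom.comp (Ideal.Quotient.mk Q), ?_⟩
  ext a
  exact f.commutes (Ideal.Quotient.mk _ a)

theorem card_eq_card_of_comp_eq {Y : Type*} (act : Y → G → Y)
    (hact : ∀ y g h, act y (g * h) = act (act y g) h) (y : Y) (g g' : G) :
    Nat.card {h // act (act y g) h = act y g'} = Nat.card {h // act y h = act y g} := by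
  refine Nat.card_congr ((Equiv.mulLeft g).trans (Equiv.mulRight (g'⁻¹ * g)) |>.subtypeEquiv ?_)
  intro h
  simp only [← hact, Equiv.trans_apply, Equiv.coe_mulLeft, Equiv.coe_mulRight]
  constructor
  · intro H
    rw [hact, H, ← hact, mul_inv_cancel_left]
  · intro H
    have := congr_arg (act · (g⁻¹ * g')) H
    simp only [← hact] at this
    simpa [mul_assoc] using this

/-- Counting the points over `Ω` fixed by `φ` of the invariant ring `A` of `G` acting on `B`. -/
theorem RingHom.card_mul_natCard_fixed_eq_sum [Fintype G] [Field Ω] [IsAlgClosed Ω]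
    [Algebra.IsInvariant A B G] [SMulCommClass G A B] [FaithfulSMul A B] [_root_.Finite (B →+* Ω)]
    (φ : Ω →+* Ω) :
    Fintype.card G * Nat.card {z : A →+* Ω // φ.comp z = z} =
      ∑ g : G, Nat.card
        {y : B →+* Ω // φ.comp y = y.comp (MulSemiringAction.toRingHom G B g)} := by
  classical
  have := Algebra.IsInvariant.isIntegral A B G
  let act (y : B →+* Ω) (g : G) := y.comp (MulSemiringAction.toRingHom G B g)
  have hact (y) (g h) : act y (g * h) = act (act y g) h := RingHom.comp_toRingHom_mul y g h
  have hactA (y) (g) : (act y g).comp (algebraMap A B) = y.comp (algebraMap A B) := by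
    ext a; simp [act, smul_algebraMap]
  have : _root_.Finite (A →+* Ω) := _root_.Finite.of_surjective
    (fun y : B →+* Ω ↦ y.comp (algebraMap A B)) RingHom.exists_comp_algebraMap_eq
  cases nonempty_fintype (A →+* Ω)
  cases nonempty_fintype (B →+* Ω)
  simp only [Nat.card_eq_fintype_card, Fintype.card_subtype, Finset.card_filter]
  rw [Finset.sum_comm, Finset.mul_sum,
    ← Finset.sum_fiberwise (s := Finset.univ) (g := fun y : B →+* Ω ↦ y.comp (algebraMap A B))]
  refine Finset.sum_congr rfl fun z _ ↦ ?_
  obtain ⟨y₀, rfl⟩ := RingHom.exists_comp_algebraMap_eq (A := A) (B := B) z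
  split_ifs with hz
  · obtain ⟨g₁, hg₁⟩ := RingHom.exists_eq_comp_toRingHom (A := A) (G := G) (y := y₀)
      (z := φ.comp y₀) (by rw [RingHom.comp_assoc, hz])
    have hfix : ∀ g, φ.comp (act y₀ g) = act y₀ (g₁ * g) := by
      intro g
      rw [hact]
      simp only [act]
      rw [← hg₁, RingHom.comp_assoc]
    have (y) (hy : y ∈ Finset.univ.filter
        fun y : B →+* Ω ↦ y.comp (algebraMap A B) = y₀.comp (algebraMap A B)) :
        (∑ g : G, if φ.comp y = y.comp (MulSemiringAction.toRingHom G B g) then 1 else 0) =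
          ∑ g : G, if act y₀ g = y then 1 else 0 := by
      obtain ⟨g, rfl⟩ := RingHom.exists_eq_comp_toRingHom (A := A) (G := G)
        (Finset.mem_filter.1 hy).2.symm
      have := card_eq_card_of_comp_eq act hact y₀ g (g₁ * g)
      rw [← hfix] at this
      simp only [Nat.card_eq_fintype_card, Fintype.card_subtype, Finset.card_filter] at this
      convert this using 3
      exact eq_comm
    rw [Finset.sum_congr rfl this, Finset.sum_comm]
    simp [Finset.sum_ite_eq, hactA]
  · simp only [mul_zero]
    symm
    refine Finset.sum_eq_zero fun y hy ↦ Finset.sum_eq_zero fun g _ ↦ if_neg fun h ↦ hz ?_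
    rw [← (Finset.mem_filter.1 hy).2, ← RingHom.comp_assoc, h]
    exact hactA y g
end

/-- The number of points `y` of `B` over `Ω` with `φ ∘ y = y ∘ σ`. -/
noncomputable def twistedCount {B Ω : Type*} [CommRing B] [CommRing Ω] (φ : Ω →+* Ω)
    (σ : B ≃+* B) : ℕ :=
  Nat.card {y : B →+* Ω // φ.comp y = y.comp (σ : B →+* B)}

theorem twistedCount_conj {B Ω : Type*} [CommRing B] [CommRing Ω] (φ : Ω →+* Ω)
    (σ τ : B ≃+* B) : twistedCount φ (τ * σ * τ⁻¹) = twistedCount φ σ := by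
  have h (y : B →+* Ω) : ((y.comp (τ : B →+* B)).comp ((τ⁻¹ : B ≃+* B) : B →+* B)) = y := by
    ext b
    exact congr_arg y (τ.apply_symm_apply b)
  have h' (y : B →+* Ω) : ((y.comp ((τ⁻¹ : B ≃+* B) : B →+* B)).comp (τ : B →+* B)) = y := by
    ext b
    exact congr_arg y (τ.symm_apply_apply b)
  let e : (B →+* Ω) ≃ (B →+* Ω) :=
    { toFun := fun y ↦ y.comp (τ : B →+* B)
      invFun := fun y ↦ y.comp ((τ⁻¹ : B ≃+* B) : B →+* B)
      left_inv := h
      right_inv := h' }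
  refine Nat.card_congr (e.subtypeEquiv fun y ↦ ?_)
  have hm : y.comp ((τ * σ * τ⁻¹ : B ≃+* B) : B →+* B) =
    (((y.comp (τ : B →+* B)).comp (σ : B →+* B)).comp ((τ⁻¹ : B ≃+* B) : B →+* B)) := rfl
  rw [hm, ← e.injective.eq_iff]
  simp only [e, Equiv.coe_fn_mk, h']
  rfl

theorem finite_ringHom_of_moduleFinite (B Ω : Type*) [CommRing B] [Module.Finite ℤ B]
    [CommRing Ω] [IsDomain Ω] : Finite (B →+* Ω) := by
  classical
  obtain ⟨s, hs⟩ := (Module.Finite.fg_top : (⊤ : Submodule ℤ B).FG)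
  have h_integral (b : B) : IsIntegral ℤ b := Algebra.IsIntegral.isIntegral b
  choose p hp using h_integral
  have h0 (b : B) : (p b).map (algebraMap ℤ Ω) ≠ 0 := ((hp b).1.map _).ne_zero
  let f (y : B →+* Ω) : ∀ b : s, ((p b).map (algebraMap ℤ Ω)).rootSet Ω := fun b ↦ ⟨y b, by
    rw [Polynomial.mem_rootSet]
    refine ⟨h0 b, ?_⟩
    rw [Polynomial.aeval_map_algebraMap]
    have := congr_arg y (hp b).2
    rw [map_zero, Polynomial.hom_eval₂] at this
    rwa [Polynomial.aeval_def, Subsingleton.elim (algebraMap ℤ Ω) (y.comp (algebraMap ℤ B))]⟩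
  refine Finite.of_injective f fun y z hyz ↦ ?_
  have : y.toIntAlgHom.toLinearMap = z.toIntAlgHom.toLinearMap := by
    refine LinearMap.ext_on hs fun b hb ↦ ?_
    exact congr_arg Subtype.val (congr_fun hyz ⟨b, hb⟩)
  exact RingHom.ext fun b ↦ LinearMap.congr_fun this b

section NumberField
variable (M F : Type*) [Field M] [Field F] [NumberField M] [NumberField F] [Algebra M F]
  [IsGalois M F]

theorem finrank_mul_natCard_ringOfIntegers_eq_galSum {Ω : Type*} [Field Ω] [IsAlgClosed Ω]
    (φ : Ω →+* Ω) :
    Module.finrank M F * (Nat.card {z : 𝓞 M →+* Ω // φ.comp z = z} : ℝ) =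
      galSum M F fun σ ↦ twistedCount φ (RingOfIntegers.mapRingEquiv σ) := by
  have := finite_ringHom_of_moduleFinite (𝓞 F) Ω
  rw [galSum, ← IsGalois.card_aut_eq_finrank, Nat.card_eq_fintype_card]
  exact_mod_cast RingHom.card_mul_natCard_fixed_eq_sum (G := F ≃ₐ[M] F) (A := 𝓞 M) (B := 𝓞 F) φ

theorem finrank_mul_natCard_eq_galSum {Ω : Type*} [Field Ω] [IsAlgClosed Ω] [CharZero Ω]
    (φ : Ω →+* Ω) :
    Module.finrank M F * (Nat.card {z : M →+* Ω // φ.comp z = z} : ℝ) =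
      galSum M F fun σ ↦ twistedCount φ σ := by
  rw [galSum, ← IsGalois.card_aut_eq_finrank, Nat.card_eq_fintype_card]
  exact_mod_cast RingHom.card_mul_natCard_fixed_eq_sum (G := F ≃ₐ[M] F) (A := M) (B := F) φ

theorem nrRealPlaces_eq_natCard (M : Type*) [Field M] [NumberField M] :
    InfinitePlace.nrRealPlaces M =
      Nat.card {z : M →+* ℂ // (starRingEnd ℂ).comp z = z} := by
  classical
  rw [← InfinitePlace.card_real_embeddings, ← Nat.card_eq_fintype_card]
  rfl

theorem finrank_rat_eq_natCard (M : Type*) [Field M] [NumberField M] :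
    Module.finrank ℚ M = Nat.card {z : M →+* ℂ // (RingHom.id ℂ).comp z = z} := by
  rw [← Embeddings.card M ℂ, ← Nat.card_eq_fintype_card]
  exact Nat.card_congr (Equiv.subtypeUnivEquiv fun z ↦ z.id_comp).symm
end NumberField

section
variable {q : ℕ} [NeZero q] (hq : Odd q)
    {K F : Type*} [Field K] [Field F] [NumberField K] [NumberField F] [Algebra K F] [IsGalois K F]
    (e : (F ≃ₐ[K] F) ≃* DihedralGroup q) (L k : IntermediateField K F)
    [NumberField L] [NumberField k]
    (hL : L = IntermediateField.fixedField
      ((Subgroup.zpowers (DihedralGroup.r (1 : ZMod q))).comap e.toMonoidHom))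
    (hk : k = IntermediateField.fixedField
      ((Subgroup.zpowers (DihedralGroup.sr (0 : ZMod q))).comap e.toMonoidHom))

include hq hL hk

theorem dihedral_natCard_ringOfIntegers {Ω : Type*} [Field Ω] [IsAlgClosed Ω]
    (φ : Ω →+* Ω) :
    Nat.card {z : 𝓞 F →+* Ω // φ.comp z = z} + 2 * Nat.card {z : 𝓞 K →+* Ω // φ.comp z = z} =
    Nat.card {z : 𝓞 L →+* Ω // φ.comp z = z} + 2 * Nat.card {z : 𝓞 k →+* Ω // φ.comp z = z} := by
  have := dihedral_relation hq e L k hL hk (fun σ τ ↦ congr_arg Nat.cast (twistedCount_conj φ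
      (RingOfIntegers.mapRingEquiv σ) (RingOfIntegers.mapRingEquiv τ)))
    (finrank_mul_natCard_ringOfIntegers_eq_galSum F F φ)
    (finrank_mul_natCard_ringOfIntegers_eq_galSum K F φ)
    (finrank_mul_natCard_ringOfIntegers_eq_galSum L F φ)
    (finrank_mul_natCard_ringOfIntegers_eq_galSum k F φ)
  exact_mod_cast this

theorem dihedral_natCard {Ω : Type*} [Field Ω] [IsAlgClosed Ω] [CharZero Ω]
    (φ : Ω →+* Ω) :
    Nat.card {z : F →+* Ω // φ.comp z = z} + 2 * Nat.card {z : K →+* Ω // φ.comp z = z} =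
    Nat.card {z : L →+* Ω // φ.comp z = z} + 2 * Nat.card {z : k →+* Ω // φ.comp z = z} := by
  have := dihedral_relation hq e L k hL hk (fun σ τ ↦ congr_arg Nat.cast (twistedCount_conj φ σ τ))
    (finrank_mul_natCard_eq_galSum F F φ) (finrank_mul_natCard_eq_galSum K F φ)
    (finrank_mul_natCard_eq_galSum L F φ) (finrank_mul_natCard_eq_galSum k F φ)
  exact_mod_cast this

theorem dihedral_nrRealPlaces :
    InfinitePlace.nrRealPlaces F + 2 * InfinitePlace.nrRealPlaces K =
      InfinitePlace.nrRealPlaces L + 2 * InfinitePlace.nrRealPlaces k := by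
  simp only [nrRealPlaces_eq_natCard]
  exact dihedral_natCard hq e L k hL hk _

theorem dihedral_nrComplexPlaces :
    InfinitePlace.nrComplexPlaces F + 2 * InfinitePlace.nrComplexPlaces K =
      InfinitePlace.nrComplexPlaces L + 2 * InfinitePlace.nrComplexPlaces k := by
  have h := dihedral_natCard hq e L k hL hk (RingHom.id ℂ)
  simp only [← finrank_rat_eq_natCard, ← InfinitePlace.card_add_two_mul_card_eq_rank] at h
  have := dihedral_nrRealPlaces hq e L k hL hk
  omega
end

theorem DihedralGroup.r_mem_of_commutator_mem {q : ℕ} (hq : Odd q) {S : Subgroup (DihedralGroup q)}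
    (hS : ∀ a b, (b * a)⁻¹ * (a * b) ∈ S) (i : ZMod q) : r i ∈ S := by
  obtain ⟨m, rfl⟩ := hq
  have h : (2 * m + 1 : ZMod (2 * m + 1)) = 0 := by
    exact_mod_cast ZMod.natCast_self (2 * m + 1)
  have h1 := hS (sr 0) (r (-m * i))
  simp only [sr_mul_r, r_mul_sr, inv_sr, sr_mul_sr] at h1
  convert h1 using 2
  linear_combination i * h

theorem NumberField.Units.exists_isPrimitiveRoot_torsionOrder (M : Type*) [Field M]
    [NumberField M] : ∃ ζ : M, IsPrimitiveRoot ζ (torsionOrder M) := by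
  obtain ⟨ζ, hζ⟩ := IsCyclic.exists_ofOrder_eq_natCard (α := torsion M)
  refine ⟨(ζ : (𝓞 M)ˣ), ?_⟩
  rw [IsPrimitiveRoot.coe_coe_iff, torsionOrder, ← hζ, ← Subgroup.orderOf_coe]
  exact IsPrimitiveRoot.orderOf _

theorem NumberField.Units.torsionOrder_eq_of_forall_mem_range {M F : Type*} [Field M] [Field F]
    [NumberField M] [NumberField F] [Algebra M F]
    (h : ∀ ζ : F, IsPrimitiveRoot ζ (torsionOrder F) → ζ ∈ (algebraMap M F).range) :
    torsionOrder M = torsionOrder F := by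
  refine Nat.dvd_antisymm ?_ ?_
  · obtain ⟨ζ, hζ⟩ := exists_isPrimitiveRoot_torsionOrder M
    exact dvd_torsionOrder_of_isPrimitiveRoot
      (hζ.map_of_injective (FaithfulSMul.algebraMap_injective M F))
  · obtain ⟨ζ, hζ⟩ := exists_isPrimitiveRoot_torsionOrder F
    obtain ⟨z, rfl⟩ := h ζ hζ
    exact dvd_torsionOrder_of_isPrimitiveRoot
      (hζ.of_map_of_injective (FaithfulSMul.algebraMap_injective M F))

section
variable {q : ℕ} [NeZero q] (hq : Odd q)
    {K F : Type*} [Field K] [Field F] [NumberField K] [NumberField F] [Algebra K F] [IsGalois K F]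
    (e : (F ≃ₐ[K] F) ≃* DihedralGroup q) (L k : IntermediateField K F)
    [NumberField L] [NumberField k]
    (hL : L = IntermediateField.fixedField
      ((Subgroup.zpowers (DihedralGroup.r (1 : ZMod q))).comap e.toMonoidHom))
    (hk : k = IntermediateField.fixedField
      ((Subgroup.zpowers (DihedralGroup.sr (0 : ZMod q))).comap e.toMonoidHom))

omit [NeZero q] [NumberField K] [NumberField F] [IsGalois K F] in
include hq in
theorem dihedral_r_apply_of_isPrimitiveRoot {n : ℕ} [NeZero n] {ζ : F} (hζ : IsPrimitiveRoot ζ n)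
    (i : ZMod q) : e.symm (DihedralGroup.r i) ζ = ζ := by
  let S : Subgroup (DihedralGroup q) :=
    (MulAction.stabilizer (F ≃ₐ[K] F) ζ).comap e.symm.toMonoidHom
  refine DihedralGroup.r_mem_of_commutator_mem (S := S) hq (fun a b ↦ ?_) i
  have hpow (σ : F ≃ₐ[K] F) : ∃ i, ζ ^ i = σ ζ := by
    obtain ⟨i, -, hi⟩ := hζ.eq_pow_of_pow_eq_one (ξ := σ ζ)
      (by rw [← map_pow, hζ.pow_eq_one, map_one])
    exact ⟨i, hi⟩
  obtain ⟨i, hi⟩ := hpow (e.symm a)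
  obtain ⟨j, hj⟩ := hpow (e.symm b)
  simp only [S, Subgroup.mem_comap, MulAction.mem_stabilizer_iff, MulEquiv.toMonoidHom_eq_coe,
    MonoidHom.coe_coe, map_mul, map_inv]
  rw [mul_smul, inv_smul_eq_iff, mul_smul, mul_smul]
  simp only [AlgEquiv.smul_def]
  rw [← hi, ← hj, map_pow, map_pow, ← hi, ← hj, ← pow_mul, ← pow_mul, mul_comm]

omit [NumberField K] [IsGalois K F] in
include hq hL in
theorem dihedral_torsionOrder_rotation : torsionOrder L = torsionOrder F := by
  refine torsionOrder_eq_of_forall_mem_range fun ζ hζ ↦ ⟨⟨ζ, ?_⟩, rfl⟩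
  rw [hL, IntermediateField.mem_fixedField_iff]
  intro σ hσ
  obtain ⟨i, hi⟩ := (DihedralGroup.mem_zpowers_r_iff _).1 (Subgroup.mem_comap.1 hσ)
  have := dihedral_r_apply_of_isPrimitiveRoot hq e hζ i
  rw [← hi] at this
  simpa using this

omit [NeZero q] in
include hq hk in
theorem dihedral_torsionOrder_reflection : torsionOrder K = torsionOrder k := by
  refine torsionOrder_eq_of_forall_mem_range fun ζ hζ ↦ ?_
  have hr := dihedral_r_apply_of_isPrimitiveRoot hq e (hζ.map_of_injective
    (FaithfulSMul.algebraMap_injective k F))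
  have hs : e.symm (DihedralGroup.sr 0) (ζ : F) = ζ := by
    have := (IntermediateField.mem_fixedField_iff _ _).1 (hk.le ζ.2)
    exact this _ (by simp)
  have : (ζ : F) ∈ (⊥ : IntermediateField K F) := by
    rw [IsGalois.mem_bot_iff_fixed]
    intro σ
    obtain ⟨g, rfl⟩ := e.symm.surjective σ
    obtain i | i := g
    · exact hr i
    · have : DihedralGroup.sr i = DihedralGroup.sr 0 * DihedralGroup.r i := by simp
      rw [this, map_mul, AlgEquiv.mul_apply]
      rw [show e.symm (DihedralGroup.r i) (ζ : F) = ζ from hr i, hs]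
  obtain ⟨z, hz⟩ := IntermediateField.mem_bot.1 this
  exact ⟨z, Subtype.ext hz⟩
end

theorem Ideal.le_of_forall_exists_mul_eq {R : Type*} [CommRing R] {I J : Ideal R}
    (h : ∀ P : Ideal R, P.IsMaximal → ∃ C D : Ideal R, ¬C ≤ P ∧ I * C = J * D) : I ≤ J := by
  intro x hx
  by_contra hxJ
  have : J.colon {x} ≠ ⊤ := fun H ↦ hxJ <| by
    have h1 : (1 : R) ∈ J.colon {x} := H ▸ Submodule.mem_top
    rwa [Submodule.mem_colon_singleton, one_smul] at h1
  obtain ⟨P, hP, hJP⟩ := Ideal.exists_le_maximal _ this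
  obtain ⟨C, D, hC, hCD⟩ := h P hP
  refine hC (le_trans (fun c hc ↦ ?_) hJP)
  rw [Submodule.mem_colon_singleton, smul_eq_mul, mul_comm]
  have hxc := Ideal.mul_mem_mul hx hc
  rw [hCD] at hxc
  exact Ideal.mul_le_left hxc

theorem Ideal.eq_of_forall_exists_mul_eq {R : Type*} [CommRing R] {I J : Ideal R}
    (h : ∀ P : Ideal R, P.IsMaximal → ∃ C D : Ideal R, ¬C ≤ P ∧ ¬D ≤ P ∧ I * C = J * D) :
    I = J := by
  refine le_antisymm (le_of_forall_exists_mul_eq fun P hP ↦ ?_)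
    (le_of_forall_exists_mul_eq fun P hP ↦ ?_)
  all_goals obtain ⟨C, D, hC, hD, hCD⟩ := h P hP
  exacts [⟨C, D, hC, hCD⟩, ⟨D, C, hD, hCD.symm⟩]

section
variable {B : Type*} [CommRing B] [IsDedekindDomain B]

/-- There is a lift of a generator of the residue field at `P` of which the polynomial
`X ^ N - X` takes a value with valuation one. -/
theorem Ideal.exists_forall_pow_sub_mem_and_pow_card_sub_notMem_sq (P : Ideal B) [hP : P.IsMaximal]
    (hP0 : P ≠ ⊥) [Finite (B ⧸ P)] :
    ∃ a : B, a ∉ P ∧ (∀ b, b ∈ P ∨ ∃ n, b - a ^ n ∈ P) ∧ a ^ Nat.card (B ⧸ P) - a ∈ P ∧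
      a ^ Nat.card (B ⧸ P) - a ∉ P ^ 2 := by
  let := Ideal.Quotient.field P
  cases nonempty_fintype (B ⧸ P)
  obtain ⟨g, hg⟩ := IsCyclic.exists_generator (α := (B ⧸ P)ˣ)
  obtain ⟨a, ha⟩ := Ideal.Quotient.mk_surjective (g : B ⧸ P)
  have key (c : B) (hc : Ideal.Quotient.mk P c = g) :
      c ∉ P ∧ (∀ b, b ∈ P ∨ ∃ n, b - c ^ n ∈ P) ∧ c ^ Nat.card (B ⧸ P) - c ∈ P := by
    refine ⟨?_, fun b ↦ ?_, ?_⟩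
    · rw [← Ideal.Quotient.eq_zero_iff_mem, hc]
      exact g.ne_zero
    · refine or_iff_not_imp_left.2 fun hb ↦ ?_
      rw [← Ideal.Quotient.eq_zero_iff_mem] at hb
      obtain ⟨n, hn⟩ := mem_powers_iff_mem_zpowers.2 (hg (Units.mk0 _ hb))
      refine ⟨n, Ideal.Quotient.eq.1 ?_⟩
      rw [map_pow, hc]
      exact (congr_arg Units.val hn).symm
    · rw [← Ideal.Quotient.eq, map_pow, Nat.card_eq_fintype_card, FiniteField.pow_card]
  by_cases h2 : a ^ Nat.card (B ⧸ P) - a ∈ P ^ 2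
  · obtain ⟨π, hπ, hπ2⟩ := Ideal.exists_mem_pow_notMem_pow_succ P hP0 hP.ne_top 1
    rw [pow_one] at hπ
    have hmk : Ideal.Quotient.mk P (a + π) = g := by
      rw [map_add, ha, Ideal.Quotient.eq_zero_iff_mem.2 hπ, add_zero]
    refine ⟨a + π, (key _ hmk).1, (key _ hmk).2.1, (key _ hmk).2.2, fun h ↦ hπ2 ?_⟩
    have hN : (Nat.card (B ⧸ P) : B) ∈ P := by
      rw [← Ideal.Quotient.eq_zero_iff_mem, map_natCast, Nat.card_eq_fintype_card,
        Nat.cast_card_eq_zero]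
    obtain ⟨c, hc⟩ := Polynomial.powAddExpansion a π (Nat.card (B ⧸ P))
    have h3 : (Nat.card (B ⧸ P) : B) * π ∈ P ^ 2 := sq P ▸ Ideal.mul_mem_mul hN hπ
    have h4 : π ^ 2 ∈ P ^ 2 := Ideal.pow_mem_pow hπ 2
    have : π = a ^ Nat.card (B ⧸ P) - a + a ^ (Nat.card (B ⧸ P) - 1) * (Nat.card (B ⧸ P) * π) +
        c * π ^ 2 - ((a + π) ^ Nat.card (B ⧸ P) - (a + π)) := by
      rw [hc]; ring
    rw [this]
    exact sub_mem (add_mem (add_mem h2 (Ideal.mul_mem_left _ _ h3)) (Ideal.mul_mem_left _ _ h4)) h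
  · exact ⟨a, (key a ha).1, (key a ha).2.1, (key a ha).2.2, h2⟩

theorem Ideal.eq_of_le_of_forall_isMaximal {I : Ideal B} (P : Ideal B) [P.IsMaximal] (hI : I ≤ P)
    (hI2 : ¬I ≤ P ^ 2) (h : ∀ P' : Ideal B, P'.IsMaximal → I ≤ P' → P' = P) : I = P := by
  obtain ⟨J, rfl⟩ := Ideal.dvd_iff_le.2 hI
  by_cases hJ : J = ⊤
  · rw [hJ, Ideal.mul_top]
  · obtain ⟨P', hP', hJP'⟩ := Ideal.exists_le_maximal J hJ
    have := h P' hP' (Ideal.mul_le_right.trans hJP')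
    subst this
    exact (hI2 (by rw [sq]; exact Ideal.mul_mono_right hJP')).elim

variable {A : Type*} [CommRing A] [Algebra A B]

/-- A local generator at `P` that is divisible by all other primes over `P ∩ A`. -/
theorem Ideal.exists_conductor_not_le [Module.Finite A B] (P : Ideal B) [hP : P.IsMaximal]
    (hP0 : (P.under A).map (algebraMap A B) ≠ ⊥) [Finite (B ⧸ P)] :
    ∃ x : B, x ∉ P ∧
      (∀ P' : Ideal B, P'.IsPrime → P'.under A = P.under A → P' ≠ P → x ∈ P') ∧
      ¬conductor A x ≤ P := by
  have hPbot : P ≠ ⊥ := fun h ↦ hP0 (le_bot_iff.1 (h ▸ Ideal.map_comap_le))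
  obtain ⟨a, haP, hgen, hN, hN2⟩ := P.exists_forall_pow_sub_mem_and_pow_card_sub_notMem_sq hPbot
  obtain ⟨m, Q, hQ, hPQ⟩ := WfDvdMonoid.max_power_factor (a₀ := (P.under A).map (algebraMap A B))
    hP0 (Ideal.prime_of_isPrime hPbot hP.isPrime).irreducible
  have hcop : IsCoprime (P ^ 2) Q := by
    refine IsCoprime.pow_left (Ideal.isCoprime_iff_sup_eq.2 (hP.1.2 _ (left_lt_sup.2 ?_)))
    rwa [← Ideal.dvd_iff_le]
  obtain ⟨v, hv, u, hu, hvu⟩ := Ideal.isCoprime_iff_exists.1 hcop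
  set N := Nat.card (B ⧸ P) with hNdef
  obtain ⟨n, hn0, hn⟩ : ∃ n, n ≠ 0 ∧ N = n + 1 := by
    have : Nontrivial (B ⧸ P) := Ideal.Quotient.nontrivial_iff.2 hP.ne_top
    have := Finite.one_lt_card (α := B ⧸ P)
    exact ⟨N - 1, by omega, by omega⟩
  set x := u * a with hx
  have hxa : Ideal.Quotient.mk (P ^ 2) x = Ideal.Quotient.mk (P ^ 2) a := by
    rw [Ideal.Quotient.eq]
    have : x - a = -a * v := by rw [hx]; linear_combination a * hvu
    exact this ▸ Ideal.mul_mem_left _ _ hv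
  have hxaP : Ideal.Quotient.mk P x = Ideal.Quotient.mk P a :=
    Ideal.Quotient.eq.2 (Ideal.pow_le_self two_ne_zero (Ideal.Quotient.eq.1 hxa))
  have hxQ : x ∈ Q := Ideal.mul_mem_right _ _ hu
  have hxP : x ∉ P := by
    rwa [← Ideal.Quotient.eq_zero_iff_mem, hxaP, Ideal.Quotient.eq_zero_iff_mem]
  have hxP' (P' : Ideal B) (hP' : P'.IsPrime) (hle : (P.under A).map (algebraMap A B) ≤ P')
      (hne : P' ≠ P) : x ∈ P' := by
    rw [hPQ, hP'.mul_le] at hle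
    obtain hle | hle := hle
    · exact (hne (hP.eq_of_le hP'.ne_top (hP'.le_of_pow_le hle)).symm).elim
    · exact hle hxQ
  refine ⟨x, hxP, fun P' hP' hu hne ↦ hxP' P' hP' (hu ▸ Ideal.map_comap_le) hne, ?_⟩
  set w := x ^ n - 1 with hw
  have hwx : x * w = x ^ N - x := by rw [hw, hn]; ring
  have hwP : w ∈ P := by
    refine (hP.isPrime.mem_or_mem (x := x) ?_).resolve_left hxP
    rw [hwx, ← Ideal.Quotient.eq, map_pow, hxaP, ← map_pow, Ideal.Quotient.eq]
    exact hN
  have hwP2 : w ∉ P ^ 2 := by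
    intro h
    refine hN2 ?_
    rw [← Ideal.Quotient.eq, map_pow, ← hxa, ← map_pow, Ideal.Quotient.eq, ← hwx]
    exact Ideal.mul_mem_left _ _ h
  let R := Algebra.adjoin A {x}
  let xR : R := ⟨x, Algebra.self_mem_adjoin_singleton A x⟩
  let 𝔮 : Ideal R := P.comap (algebraMap R B)
  have hle : (P.under A).map (algebraMap A B) ⊔ Ideal.span {w} ≤ 𝔮.map (algebraMap R B) := by
    refine sup_le (Ideal.map_le_iff_le_comap.2 fun y hy ↦ ?_) ?_
    · exact Ideal.mem_map_of_mem (algebraMap R B) (x := algebraMap A R y) hy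
    · rw [Ideal.span_singleton_le_iff_mem]
      exact Ideal.mem_map_of_mem (algebraMap R B) (x := xR ^ n - 1) hwP
  have hPeq : (P.under A).map (algebraMap A B) ⊔ Ideal.span {w} = P := by
    refine Ideal.eq_of_le_of_forall_isMaximal P
      (sup_le Ideal.map_comap_le ((Ideal.span_singleton_le_iff_mem _).2 hwP)) ?_ ?_
    · exact fun h ↦ hwP2 ((Ideal.span_singleton_le_iff_mem _).1 (le_sup_right.trans h))
    · intro P' hP' hle
      by_contra hne
      have h1 := hxP' P' hP'.isPrime (le_sup_left.trans hle) hne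
      have h2 := le_sup_right.trans hle (Ideal.mem_span_singleton_self w)
      exact hP'.ne_top ((Ideal.eq_top_iff_one _).2
        (by simpa [hw] using sub_mem (P'.pow_mem_of_mem h1 n (Nat.pos_of_ne_zero hn0)) h2))
  have hq : 𝔮.map (algebraMap R B) = P := le_antisymm Ideal.map_comap_le (hPeq.symm.le.trans hle)
  have : Module.Finite R B := Module.Finite.of_restrictScalars_finite A R B
  let U : Submodule R B := 1
  have hRP (b : B) : ∃ r ∈ U, b - r ∈ P := by
    obtain hb | ⟨i, hi⟩ := hgen b
    · exact ⟨0, zero_mem _, by simpa using hb⟩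
    · refine ⟨x ^ i, Submodule.mem_one.2 ⟨xR ^ i, rfl⟩, ?_⟩
      rwa [← Ideal.Quotient.eq, map_pow, hxaP, ← map_pow, Ideal.Quotient.eq]
  have hsmul : (⊤ : Submodule R (B ⧸ U)) ≤ 𝔮 • ⊤ := by
    rintro b -
    obtain ⟨b, rfl⟩ := Submodule.Quotient.mk_surjective _ b
    obtain ⟨r, hr, hb⟩ := hRP b
    rw [← sub_add_cancel b r, Submodule.Quotient.mk_add,
      (Submodule.Quotient.mk_eq_zero U).2 hr, add_zero]
    have h : b - r ∈ 𝔮 • (⊤ : Submodule R B) := by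
      rw [Ideal.smul_top_eq_map, hq]
      exact hb
    have := Submodule.mem_map_of_mem (f := U.mkQ) h
    rw [Submodule.map_smul''] at this
    exact Submodule.smul_mono le_rfl le_top this
  obtain ⟨r, hr1, hr⟩ := Submodule.exists_sub_one_mem_and_smul_eq_zero_of_fg_of_le_smul 𝔮
    (⊤ : Submodule R (B ⧸ U)) Module.Finite.fg_top hsmul
  intro hle
  have hrc : (r : B) ∈ conductor A x := by
    intro b
    have := hr (Submodule.Quotient.mk b) trivial
    rw [← Submodule.Quotient.mk_smul, Submodule.Quotient.mk_eq_zero] at this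
    obtain ⟨c, hc⟩ := Submodule.mem_one.1 this
    have : (r : B) * b = c := hc.symm
    exact this ▸ c.2
  have h1 : (r : B) - 1 ∈ P := hr1
  exact hP.ne_top ((Ideal.eq_top_iff_one _).2 (by simpa using sub_mem (hle hrc) h1))
end

section
variable {B : Type*} [CommRing B]

/-- The ideal generated by the differences `g • x - x`. -/
def diffIdeal (B : Type*) [CommRing B] (σ : B →+* B) : Ideal B :=
  Ideal.span (Set.range fun x ↦ σ x - x)

theorem sub_mem_diffIdeal (σ : B →+* B) (x : B) : σ x - x ∈ diffIdeal B σ :=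
  Ideal.subset_span ⟨x, rfl⟩

/-- `c` multiplies differences into the ideal generated by `σ x - x` if it comes from the
conductor of `x`. -/
theorem map_mul_mem_span_of_mem_conductor {A : Type*} [CommRing A] [Algebra A B] (σ : B →ₐ[A] B)
    {x c : B} (hc : c ∈ conductor A x) {y : B} (hy : y ∈ diffIdeal B σ) :
    σ c * y ∈ Ideal.span {σ x - x} := by
  have key (z : B) (hz : z ∈ Algebra.adjoin A {x}) : σ z - z ∈ Ideal.span {σ x - x} := by
    obtain ⟨p, rfl⟩ := Algebra.adjoin_singleton_eq_range_aeval A x ▸ hz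
    rw [Ideal.mem_span_singleton]
    have := Polynomial.sub_dvd_eval_sub (σ x) x (p.map (algebraMap A B))
    simpa [Polynomial.eval_map_algebraMap, Polynomial.aeval_algHom_apply] using this
  induction hy using Submodule.span_induction with
  | zero => simp
  | add y z _ _ hy hz => rw [mul_add]; exact add_mem hy hz
  | smul a y _ hy =>
    rw [smul_eq_mul, mul_left_comm]
    exact Ideal.mul_mem_left _ _ hy
  | mem y hy =>
    obtain ⟨y, rfl⟩ := hy
    have h1 := key _ (hc y)
    have h2 := key c (by simpa using hc 1)
    have : σ c * (σ y - y) = (σ (c * y) - c * y) - (σ c - c) * y := by rw [map_mul]; ring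
    change σ c * (σ y - y) ∈ _
    rw [this]
    exact sub_mem h1 (Ideal.mul_mem_right _ _ h2)

theorem exists_span_eq_diffIdeal_mul [IsDedekindDomain B] {A : Type*} [CommRing A] [Algebra A B]
    (σ : B ≃ₐ[A] B) (P : Ideal B) [hP : P.IsPrime] {x : B} (hxP : x ∉ P)
    (hx : ∀ P' : Ideal B, P'.IsPrime → P'.under A = P.under A → P' ≠ P → x ∈ P')
    (hc : ¬conductor A x ≤ P) :
    ∃ J : Ideal B, ¬J ≤ P ∧ Ideal.span {x - σ x} = diffIdeal B σ * J := by
  have hspan : Ideal.span {x - σ x} = Ideal.span {σ x - x} := by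
    rw [← Ideal.span_singleton_neg, neg_sub]
  obtain ⟨J, hJ⟩ := Ideal.dvd_iff_le.2 ((Ideal.span_singleton_le_iff_mem _).2
    (sub_mem_diffIdeal (σ : B →+* B) x))
  replace hJ : Ideal.span {σ x - x} = diffIdeal B (σ : B →+* B) * J := hJ
  by_cases h0 : diffIdeal B (σ : B →+* B) = ⊥
  · refine ⟨⊤, fun h ↦ hP.ne_top (top_le_iff.1 h), ?_⟩
    rw [hspan, hJ, h0, Ideal.bot_mul, Ideal.bot_mul]
  refine ⟨J, fun hJP ↦ ?_, hspan.trans hJ⟩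
  by_cases hσ : P.comap (σ : B →+* B) = P
  · obtain ⟨c, hc, hcP⟩ := SetLike.not_le_iff_exists.1 hc
    have h1 : Ideal.span {σ c} * diffIdeal B σ ≤ diffIdeal B σ * J := by
      rw [← hJ, Ideal.mul_le]
      intro r hr s hs
      obtain ⟨t, rfl⟩ := Ideal.mem_span_singleton'.1 hr
      rw [mul_assoc]
      exact Ideal.mul_mem_left _ _ (map_mul_mem_span_of_mem_conductor (σ : B →ₐ[A] B) hc hs)
    rw [mul_comm, ← Ideal.dvd_iff_le, mul_dvd_mul_iff_left h0, Ideal.dvd_iff_le] at h1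
    exact hcP (hσ ▸ hJP (h1 (Ideal.mem_span_singleton_self _)))
  · have h1 : x ∈ P.comap (σ : B →+* B) := by
      refine hx _ (Ideal.comap_isPrime _ _) ?_ hσ
      ext a
      simp [Ideal.mem_comap]
    have h2 := Ideal.mem_span_singleton_self (σ x - x)
    rw [hJ] at h2
    have h4 : diffIdeal B (σ : B →+* B) * J ≤ P := Ideal.mul_le_right.trans hJP
    have h3 := P.sub_mem (Ideal.mem_comap.1 h1) (h4 h2)
    exact hxP (by simpa using h3)
end

section
variable {M F : Type*} [Field M] [Field F] [NumberField M] [NumberField F] [Algebra M F]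

theorem adjoin_eq_top_of_conductor_ne_bot {x : 𝓞 F} (hx : conductor (𝓞 M) x ≠ ⊥) :
    Algebra.adjoin M {(algebraMap (𝓞 F) F x)} = ⊤ := by
  obtain ⟨c, hc, hc0⟩ := Submodule.exists_mem_ne_zero_of_ne_bot hx
  have hmem (y : 𝓞 F) (hy : y ∈ Algebra.adjoin (𝓞 M) {x}) :
      algebraMap (𝓞 F) F y ∈ IntermediateField.adjoin M {(algebraMap (𝓞 F) F x)} := by
    obtain ⟨p, rfl⟩ := Algebra.adjoin_singleton_eq_range_aeval (𝓞 M) x ▸ hy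
    have : algebraMap (𝓞 F) F (Polynomial.aeval x p) =
        Polynomial.aeval (algebraMap (𝓞 F) F x) (p.map (algebraMap (𝓞 M) M)) := by
      rw [Polynomial.aeval_map_algebraMap, Polynomial.aeval_algebraMap_apply]
    change algebraMap (𝓞 F) F (Polynomial.aeval x p) ∈ _
    rw [this]
    exact IntermediateField.algebra_adjoin_le_adjoin _ _
      (Polynomial.aeval_mem_adjoin_singleton _ _)
  have hB (y : 𝓞 F) :
      algebraMap (𝓞 F) F y ∈ IntermediateField.adjoin M {(algebraMap (𝓞 F) F x)} := by
    have h1 := hmem _ (hc y)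
    have h2 := hmem c (by simpa using hc 1)
    rw [map_mul] at h1
    have := div_mem h1 h2
    rwa [mul_div_cancel_left₀] at this
    exact (map_ne_zero_iff _ (FaithfulSMul.algebraMap_injective _ _)).2 hc0
  have htop : IntermediateField.adjoin M {(algebraMap (𝓞 F) F x)} = ⊤ := by
    refine eq_top_iff.2 fun y _ ↦ ?_
    obtain ⟨a, b, hb, rfl⟩ := IsFractionRing.div_surjective (A := 𝓞 F) y
    exact div_mem (hB a) (hB b)
  rw [← IntermediateField.adjoin_simple_toSubalgebra_of_isAlgebraic
    (Algebra.IsAlgebraic.isAlgebraic _), htop, IntermediateField.top_toSubalgebra]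

open Polynomial in
theorem minpoly_map_eq_prod [IsGalois M F] {x : F} (hx : Algebra.adjoin M {x} = ⊤) :
    (minpoly M x).map (algebraMap M F) = ∏ σ : F ≃ₐ[M] F, (X - C (σ x)) := by
  have hinj : Function.Injective fun σ : F ≃ₐ[M] F ↦ σ x := fun σ τ h ↦ by
    refine AlgEquiv.coe_toAlgHom_injective (AlgHom.ext_of_adjoin_eq_top hx ?_)
    simpa using h
  have hdvd : ∏ σ : F ≃ₐ[M] F, (X - C (σ x)) ∣ (minpoly M x).map (algebraMap M F) := by
    refine Finset.prod_dvd_of_coprime (fun σ _ τ _ h ↦ ?_) fun σ _ ↦ ?_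
    · exact pairwise_coprime_X_sub_C hinj h
    · rw [dvd_iff_isRoot, IsRoot.def, eval_map_algebraMap]
      rw [← AlgEquiv.coe_toAlgHom, aeval_algHom_apply, minpoly.aeval, map_zero]
  have hx_int : IsIntegral M x := Algebra.IsIntegral.isIntegral x
  refine eq_of_monic_of_dvd_of_natDegree_le (monic_prod_of_monic _ _ fun σ _ ↦ monic_X_sub_C _)
    ((minpoly.monic hx_int).map _) hdvd ?_
  rw [natDegree_map, natDegree_prod_of_monic _ _ fun σ _ ↦ monic_X_sub_C _]
  simp only [natDegree_X_sub_C, Finset.sum_const, Finset.card_univ, smul_eq_mul, mul_one]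
  rw [← Nat.card_eq_fintype_card, IsGalois.card_aut_eq_finrank]
  exact minpoly.natDegree_le x

open Polynomial Classical in
theorem aeval_derivative_minpoly_eq_prod [IsGalois M F] {x : 𝓞 F}
    (hx : Algebra.adjoin M {(algebraMap (𝓞 F) F x)} = ⊤) :
    aeval x (derivative (minpoly (𝓞 M) x)) =
      ∏ σ ∈ Finset.univ.erase (1 : F ≃ₐ[M] F), (x - RingOfIntegers.mapAlgEquiv σ x) := by
  refine FaithfulSMul.algebraMap_injective (𝓞 F) F ?_
  rw [← aeval_algebraMap_apply, map_prod, ← aeval_map_algebraMap M, ← derivative_map,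
    ← minpoly.isIntegrallyClosed_eq_field_fractions M F (Algebra.IsIntegral.isIntegral x)]
  rw [← eval_map_algebraMap, ← derivative_map, minpoly_map_eq_prod hx,
    ← Finset.mul_prod_erase _ _ (Finset.mem_univ 1)]
  simp [derivative_mul, eval_prod]
  rfl

open Classical in
theorem differentIdeal_eq_prod_diffIdeal [IsGalois M F] :
    differentIdeal (𝓞 M) (𝓞 F) = ∏ σ ∈ Finset.univ.erase (1 : F ≃ₐ[M] F),
      diffIdeal (𝓞 F) (RingOfIntegers.mapRingEquiv σ.toRingEquiv : 𝓞 F →+* 𝓞 F) := by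
  refine Ideal.eq_of_forall_exists_mul_eq fun P hP ↦ ?_
  have hPbot : P ≠ ⊥ := Ring.ne_bot_of_isMaximal_of_not_isField hP (RingOfIntegers.not_isField F)
  have hP0 : (P.under (𝓞 M)).map (algebraMap (𝓞 M) (𝓞 F)) ≠ ⊥ := by
    rw [Ne, Ideal.map_eq_bot_iff_of_injective (FaithfulSMul.algebraMap_injective _ _)]
    exact Ideal.IsIntegral.comap_ne_bot _ hPbot
  have : Finite (𝓞 F ⧸ P) := Ideal.finiteQuotientOfFreeOfNeBot P hPbot
  obtain ⟨x, hxP, hx, hc⟩ := Ideal.exists_conductor_not_le (A := 𝓞 M) P hP0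
  choose J hJP hJ using fun σ : F ≃ₐ[M] F ↦ exists_span_eq_diffIdeal_mul
    (RingOfIntegers.mapAlgEquiv σ : 𝓞 F ≃ₐ[𝓞 M] 𝓞 F) P hxP hx hc
  refine ⟨conductor (𝓞 M) x, ∏ σ ∈ Finset.univ.erase (1 : F ≃ₐ[M] F), J σ, hc, ?_, ?_⟩
  · rw [hP.isPrime.prod_le]
    rintro ⟨σ, -, hσ⟩
    exact hJP σ hσ
  · have hadj := adjoin_eq_top_of_conductor_ne_bot (M := M) (x := x)
      fun h ↦ hc (h ▸ bot_le)
    rw [mul_comm, conductor_mul_differentIdeal (𝓞 M) M F x hadj,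
      aeval_derivative_minpoly_eq_prod hadj, ← Ideal.prod_span_singleton, ← Finset.prod_mul_distrib]
    exact Finset.prod_congr rfl fun σ _ ↦ hJ σ
end

theorem absNorm_diffIdeal_conj {B : Type*} [CommRing B] [IsDedekindDomain B] [Module.Free ℤ B]
    (σ τ : B ≃+* B) :
    Ideal.absNorm (diffIdeal B ((τ * σ * τ⁻¹ : B ≃+* B) : B →+* B)) =
      Ideal.absNorm (diffIdeal B (σ : B →+* B)) := by
  rw [Ideal.absNorm_apply, Ideal.absNorm_apply, Submodule.cardQuot_apply, Submodule.cardQuot_apply]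
  refine (Nat.card_congr (Ideal.quotientEquiv _ _ τ ?_).toEquiv).symm
  rw [diffIdeal, diffIdeal, Ideal.map_span, ← Set.range_comp,
    ← (τ : B ≃ B).surjective.range_comp]
  congr 2
  ext x
  change τ (σ (τ.symm (τ x))) - τ x = τ (σ x - x)
  rw [τ.symm_apply_apply, map_sub]

open Classical in
/-- A class function on `Aut F` whose sums over Galois groups give discriminants. -/
noncomputable def logRamification (F : Type*) [Field F] [NumberField F] (σ : F ≃+* F) : ℝ :=
  if σ = 1 then Real.log (discr F).natAbs else
    -Real.log (Ideal.absNorm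
      (diffIdeal (𝓞 F) (RingOfIntegers.mapRingEquiv σ : 𝓞 F →+* 𝓞 F)))

theorem logRamification_conj {F : Type*} [Field F] [NumberField F] (σ τ : F ≃+* F) :
    logRamification F (τ * σ * τ⁻¹) = logRamification F σ := by
  have := absNorm_diffIdeal_conj (RingOfIntegers.mapRingEquiv σ) (RingOfIntegers.mapRingEquiv τ)
  by_cases hσ : σ = 1
  · rw [hσ, mul_one, mul_inv_cancel]
  · have hσ' : τ * σ * τ⁻¹ ≠ 1 := mt conj_eq_one_iff.1 hσ
    rw [logRamification, logRamification, if_neg hσ, if_neg hσ', ← this]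
    rfl

theorem natAbs_discr_pos (M : Type*) [Field M] [NumberField M] : (0 : ℝ) < (discr M).natAbs := by
  simpa using discr_ne_zero M

theorem finrank_mul_log_discr_eq_galSum (M F : Type*) [Field M] [Field F] [NumberField M]
    [NumberField F] [Algebra M F] [IsGalois M F] :
    Module.finrank M F * Real.log (discr M).natAbs = galSum M F (logRamification F) := by
  classical
  have h := natAbs_discr_eq_absNorm_differentIdeal_mul_natAbs_discr_pow M (𝓞 M) F (𝓞 F)
  have h0 : Ideal.absNorm (differentIdeal (𝓞 M) (𝓞 F)) ≠ 0 := fun h0 ↦ by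
    rw [h0, zero_mul] at h
    exact (natAbs_discr_pos F).ne' (by exact_mod_cast h)
  rw [differentIdeal_eq_prod_diffIdeal, map_prod] at h h0
  have hlog := congr_arg (fun n : ℕ ↦ Real.log n) h
  simp only [Nat.cast_mul, Nat.cast_pow, Nat.cast_prod] at hlog
  rw [Real.log_mul (by exact_mod_cast h0) (pow_ne_zero _ (natAbs_discr_pos M).ne'), Real.log_pow,
    Real.log_prod fun σ hσ ↦ by exact_mod_cast Finset.prod_ne_zero_iff.1 h0 σ hσ] at hlog
  have hsum := Finset.sum_congr rfl fun σ (hσ : σ ∈ Finset.univ.erase (1 : F ≃ₐ[M] F)) ↦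
    show logRamification F σ.toRingEquiv = _ from if_neg fun hσ1 ↦
      Finset.ne_of_mem_erase hσ (AlgEquiv.ext fun x ↦ RingEquiv.congr_fun hσ1 x)
  have hone : logRamification F (1 : F ≃ₐ[M] F).toRingEquiv = Real.log (discr F).natAbs :=
    if_pos rfl
  rw [galSum, ← Finset.add_sum_erase _ _ (Finset.mem_univ 1), hsum, hone, hlog,
    Finset.sum_neg_distrib]
  ring

theorem dihedral_discr {q : ℕ} [NeZero q] (hq : Odd q)
    {K F : Type*} [Field K] [NumberField K] [Field F] [NumberField F]
    [Algebra K F] [IsGalois K F] (e : (F ≃ₐ[K] F) ≃* DihedralGroup q)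
    (L k : IntermediateField K F) [NumberField L] [NumberField k]
    (hL : L = IntermediateField.fixedField
      ((Subgroup.zpowers (DihedralGroup.r (1 : ZMod q))).comap e.toMonoidHom))
    (hk : k = IntermediateField.fixedField
      ((Subgroup.zpowers (DihedralGroup.sr (0 : ZMod q))).comap e.toMonoidHom)) :
    (discr F).natAbs * (discr K).natAbs ^ 2 = (discr L).natAbs * (discr k).natAbs ^ 2 := by
  have h := dihedral_relation hq e L k hL hk logRamification_conj
    (finrank_mul_log_discr_eq_galSum F F) (finrank_mul_log_discr_eq_galSum K F)
    (finrank_mul_log_discr_eq_galSum L F) (finrank_mul_log_discr_eq_galSum k F)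
  have := congr_arg Real.exp h
  simp only [two_mul, Real.exp_add, Real.exp_log (natAbs_discr_pos _)] at this
  rw [pow_two, pow_two]
  exact_mod_cast this

section
variable (B : Type*) [CommRing B] [IsDedekindDomain B] [Module.Free ℤ B] [Module.Finite ℤ B]
  [CharZero B]

/-- The ideals of norm `n`. -/
noncomputable def idealsOfNorm (n : ℕ) : Finset (Ideal B) :=
  (Ideal.finite_setOfPred_absNorm_eq (S := B) n).toFinset

variable {B} in
theorem mem_idealsOfNorm {n : ℕ} {I : Ideal B} : I ∈ idealsOfNorm B n ↔ Ideal.absNorm I = n := by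
  simp [idealsOfNorm]

open Classical in
/-- The prime ideals of norm at most `n`. -/
noncomputable def primesOfNormLE (n : ℕ) : Finset (Ideal B) :=
  (Ideal.finite_setOfPred_absNorm_le (S := B) n).toFinset.filter Prime

variable {B} in
theorem mem_primesOfNormLE {n : ℕ} {P : Ideal B} :
    P ∈ primesOfNormLE B n ↔ Ideal.absNorm P ≤ n ∧ Prime P := by
  simp [primesOfNormLE]

/-- The number of ideals of norm `n`, with value `0` at `0`. -/
noncomputable def idealCount : ArithmeticFunction ℂ :=
  ⟨fun n ↦ if n = 0 then 0 else (idealsOfNorm B n).card, if_pos rfl⟩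

theorem idealCount_apply {n : ℕ} (hn : n ≠ 0) : idealCount B n = (idealsOfNorm B n).card :=
  if_neg hn

theorem idealCount_one : idealCount B 1 = 1 := by
  rw [idealCount_apply B one_ne_zero, Nat.cast_eq_one, Finset.card_eq_one]
  refine ⟨⊤, ?_⟩
  ext I
  rw [mem_idealsOfNorm, Finset.mem_singleton, Ideal.absNorm_eq_one_iff]

/-- The von Mangoldt function of `B`: its value at `n` is the sum of `log (N P)` over the pairs
of a prime ideal `P` and a positive `m` with `N P ^ m = n`. -/
noncomputable def idealVonMangoldt : ArithmeticFunction ℂ :=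
  ⟨fun n ↦ ∑ P ∈ primesOfNormLE B n, ∑ m ∈ Finset.Icc 1 n,
    if Ideal.absNorm P ^ m = n then (Real.log (Ideal.absNorm P) : ℂ) else 0, by simp⟩

variable {B} in
omit [CharZero B] in
theorem one_lt_absNorm_of_prime {P : Ideal B} (hP : Prime P) : 1 < Ideal.absNorm P := by
  have h0 : Ideal.absNorm P ≠ 0 := by simpa [Ideal.absNorm_eq_zero_iff] using hP.ne_zero
  have h1 : Ideal.absNorm P ≠ 1 := by
    rw [Ne, Ideal.absNorm_eq_one_iff]
    exact fun h ↦ hP.not_isUnit (Ideal.isUnit_iff.2 h)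
  omega

theorem idealVonMangoldt_eq_sum {n N : ℕ} (hN : n ≤ N) :
    idealVonMangoldt B n = ∑ P ∈ primesOfNormLE B N, ∑ m ∈ Finset.Icc 1 N,
      if Ideal.absNorm P ^ m = n then (Real.log (Ideal.absNorm P) : ℂ) else 0 := by
  change ∑ P ∈ primesOfNormLE B n, ∑ m ∈ Finset.Icc 1 n, _ = _
  have hle {P : Ideal B} {m : ℕ} (hP : Prime P) (hm : 1 ≤ m) (h : Ideal.absNorm P ^ m = n) :
      Ideal.absNorm P ≤ n ∧ m ≤ n := by
    have h1 := one_lt_absNorm_of_prime hP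
    exact ⟨h ▸ Nat.le_self_pow (by omega) _, h ▸ (Nat.lt_pow_self h1).le⟩
  have hsub : primesOfNormLE B n ⊆ primesOfNormLE B N := fun P hP ↦ by
    rw [mem_primesOfNormLE] at hP ⊢
    exact ⟨hP.1.trans hN, hP.2⟩
  rw [← Finset.sum_subset hsub]
  · refine Finset.sum_congr rfl fun P hP ↦ ?_
    refine Finset.sum_subset (Finset.Icc_subset_Icc_right hN) fun m hm hm' ↦ if_neg fun h ↦ hm' ?_
    have hm1 := (Finset.mem_Icc.1 hm).1
    exact Finset.mem_Icc.2 ⟨hm1, (hle (mem_primesOfNormLE.1 hP).2 hm1 h).2⟩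
  · intro P hP hP'
    refine Finset.sum_eq_zero fun m hm ↦ if_neg fun h ↦ hP' ?_
    have hP1 := (mem_primesOfNormLE.1 hP).2
    exact mem_primesOfNormLE.2 ⟨(hle hP1 (Finset.mem_Icc.1 hm).1 h).1, hP1⟩

variable {B} in
open Classical in
theorem sum_idealCount_eq_card_filter_dvd {n : ℕ} (hn : n ≠ 0) {Q : Ideal B} (hQ : Q ≠ ⊥) :
    ∑ x ∈ n.divisorsAntidiagonal, (if Ideal.absNorm Q = x.2 then idealCount B x.1 else 0) =
      ((idealsOfNorm B n).filter (Q ∣ ·)).card := by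
  have hQ0 : Ideal.absNorm Q ≠ 0 := by simpa [Ideal.absNorm_eq_zero_iff] using hQ
  by_cases hdvd : Ideal.absNorm Q ∣ n
  · obtain ⟨d, rfl⟩ := hdvd
    have hd : d ≠ 0 := right_ne_zero_of_mul hn
    rw [Finset.sum_eq_single (d, Ideal.absNorm Q), if_pos rfl, idealCount_apply B hd, Nat.cast_inj]
    · refine Finset.card_nbij (Q * ·) (fun I hI ↦ ?_) (fun I _ J _ h ↦ ?_) fun I hI ↦ ?_
      · rw [Finset.mem_coe, mem_idealsOfNorm] at hI
        simp [mem_idealsOfNorm, hI]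
      · exact mul_left_cancel₀ hQ h
      · rw [Finset.mem_coe, Finset.mem_filter, mem_idealsOfNorm] at hI
        obtain ⟨hI, J, rfl⟩ := hI
        refine ⟨J, ?_, rfl⟩
        rw [map_mul] at hI
        exact mem_idealsOfNorm.2 (mul_left_cancel₀ hQ0 hI)
    · rintro ⟨x, y⟩ hxy hne
      rw [Nat.mem_divisorsAntidiagonal] at hxy
      refine if_neg fun h ↦ hne ?_
      simp only at h hxy
      rw [← h, mul_comm] at hxy
      rw [h, mul_left_cancel₀ hQ0 hxy.1]
    · intro h
      exact (h (Nat.mem_divisorsAntidiagonal.2 ⟨mul_comm _ _, hn⟩)).elim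
  · rw [Finset.sum_eq_zero, Finset.filter_eq_empty_iff.2, Finset.card_empty, Nat.cast_zero]
    · rintro I hI ⟨J, rfl⟩
      rw [mem_idealsOfNorm, map_mul] at hI
      exact hdvd ⟨_, hI.symm⟩
    · rintro ⟨x, y⟩ hxy
      rw [Nat.mem_divisorsAntidiagonal] at hxy
      exact if_neg fun h ↦ hdvd ⟨x, by rw [h, mul_comm]; exact hxy.1.symm⟩

variable {B} in
open Classical in
theorem sum_log_absNorm_eq_log {n : ℕ} (hn : n ≠ 0) {I : Ideal B} (hI : Ideal.absNorm I = n) :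
    ∑ P ∈ primesOfNormLE B n, ∑ m ∈ Finset.Icc 1 n,
      (if P ^ m ∣ I then (Real.log (Ideal.absNorm P) : ℂ) else 0) = Real.log n := by
  have hI0 : I ≠ 0 := fun h ↦ hn (by rw [← hI, h, map_zero])
  let s := UniqueFactorizationMonoid.normalizedFactors I
  have hs {P : Ideal B} (hP : P ∈ s) : Prime P :=
    UniqueFactorizationMonoid.prime_of_normalized_factor P hP
  have hprod : s.prod = I := associated_iff_eq.1
    (UniqueFactorizationMonoid.prod_normalizedFactors hI0)
  have hle {J : Ideal B} (hJ : J ∣ I) : Ideal.absNorm J ≤ n :=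
    Nat.le_of_dvd (Nat.pos_of_ne_zero hn) (hI ▸ map_dvd Ideal.absNorm hJ)
  have hsub : s.toFinset ⊆ primesOfNormLE B n := fun P hP ↦ by
    rw [Multiset.mem_toFinset] at hP
    exact mem_primesOfNormLE.2
      ⟨hle (UniqueFactorizationMonoid.dvd_of_mem_normalizedFactors hP), hs hP⟩
  have hcount {P : Ideal B} (hP : Prime P) :
      ((Finset.Icc 1 n).filter (P ^ · ∣ I)).card = s.count P := by
    rw [← Nat.add_sub_cancel (s.count P) 1, ← Nat.card_Icc]
    congr 1
    ext m
    have hm : P ^ m ∣ I ↔ m ≤ s.count P := by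
      rw [UniqueFactorizationMonoid.dvd_iff_normalizedFactors_le_normalizedFactors
        (pow_ne_zero _ hP.ne_zero) hI0, UniqueFactorizationMonoid.normalizedFactors_pow,
        UniqueFactorizationMonoid.normalizedFactors_irreducible hP.irreducible, normalize_eq,
        Multiset.nsmul_singleton, ← Multiset.le_count_iff_replicate_le]
    simp only [Finset.mem_filter, Finset.mem_Icc, hm]
    refine ⟨fun h ↦ ⟨h.1.1, h.2⟩, fun h ↦ ⟨⟨h.1, ?_⟩, h.2⟩⟩
    have := hle (hm.2 h.2)
    rw [map_pow] at this
    exact (Nat.lt_pow_self (one_lt_absNorm_of_prime hP)).le.trans this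
  have h1 : Ideal.absNorm I = ∏ P ∈ s.toFinset, Ideal.absNorm P ^ s.count P := by
    conv_lhs => rw [← hprod, Finset.prod_multiset_count, map_prod]
    simp only [map_pow]
  have h2 (P) (hP : P ∈ s.toFinset) : ((Ideal.absNorm P ^ s.count P : ℕ) : ℝ) ≠ 0 := by
    have := one_lt_absNorm_of_prime (hs (Multiset.mem_toFinset.1 hP))
    positivity
  rw [← hI, h1, Nat.cast_prod, Real.log_prod h2, Complex.ofReal_sum, h1.symm.trans hI,
    Finset.sum_subset hsub fun P _ hP ↦ by
      rw [Multiset.mem_toFinset, ← Multiset.count_eq_zero] at hP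
      simp [hP]]
  refine Finset.sum_congr rfl fun P hP ↦ ?_
  rw [← Finset.sum_filter, Finset.sum_const, hcount (mem_primesOfNormLE.1 hP).2]
  simp

open Classical in
theorem log_mul_idealCount (n : ℕ) :
    Real.log n * idealCount B n = (idealCount B * idealVonMangoldt B) n := by
  by_cases hn : n = 0
  · simp [hn]
  rw [idealCount_apply B hn, ArithmeticFunction.mul_apply]
  have h1 (x) (hx : x ∈ n.divisorsAntidiagonal) := idealVonMangoldt_eq_sum B (n := x.2) (N := n)
    (Nat.divisor_le (Nat.snd_mem_divisors_of_mem_antidiagonal hx))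
  calc (Real.log n : ℂ) * (idealsOfNorm B n).card
      = ∑ I ∈ idealsOfNorm B n, ∑ P ∈ primesOfNormLE B n, ∑ m ∈ Finset.Icc 1 n,
          (if P ^ m ∣ I then (Real.log (Ideal.absNorm P) : ℂ) else 0) := by
        rw [Finset.sum_congr rfl fun I hI ↦ sum_log_absNorm_eq_log hn (mem_idealsOfNorm.1 hI)]
        rw [Finset.sum_const, nsmul_eq_mul, mul_comm]
    _ = ∑ P ∈ primesOfNormLE B n, ∑ m ∈ Finset.Icc 1 n,
          (Real.log (Ideal.absNorm P) : ℂ) * ((idealsOfNorm B n).filter (P ^ m ∣ ·)).card := by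
        rw [Finset.sum_comm]
        refine Finset.sum_congr rfl fun P _ ↦ ?_
        rw [Finset.sum_comm]
        refine Finset.sum_congr rfl fun m _ ↦ ?_
        rw [← Finset.sum_filter, Finset.sum_const, nsmul_eq_mul, mul_comm]
    _ = ∑ P ∈ primesOfNormLE B n, ∑ m ∈ Finset.Icc 1 n, ∑ x ∈ n.divisorsAntidiagonal,
          idealCount B x.1 * if Ideal.absNorm P ^ m = x.2 then
            (Real.log (Ideal.absNorm P) : ℂ) else 0 := by
        refine Finset.sum_congr rfl fun P hP ↦ Finset.sum_congr rfl fun m _ ↦ ?_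
        rw [← sum_idealCount_eq_card_filter_dvd hn
          (pow_ne_zero m (mem_primesOfNormLE.1 hP).2.ne_zero), Finset.mul_sum, map_pow]
        refine Finset.sum_congr rfl fun x _ ↦ ?_
        rw [mul_ite, mul_ite, mul_zero, mul_zero, mul_comm]
    _ = _ := by
        rw [Finset.sum_congr rfl fun P _ ↦ Finset.sum_comm, Finset.sum_comm]
        refine Finset.sum_congr rfl fun x hx ↦ ?_
        rw [h1 x hx, Finset.mul_sum]
        exact Finset.sum_congr rfl fun P _ ↦ (Finset.mul_sum _ _ _).symm

end

section
variable {f g l l' : ArithmeticFunction ℂ}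

theorem log_mul_mul_apply (hf : ∀ n : ℕ, Real.log n * f n = (f * l) n)
    (hg : ∀ n : ℕ, Real.log n * g n = (g * l') n) (n : ℕ) :
    Real.log n * (f * g) n = (f * g * (l + l')) n := by
  have h : f * g * (l + l') = f * l * g + f * (g * l') := by ring
  rw [h, ArithmeticFunction.add_apply, ArithmeticFunction.mul_apply, ArithmeticFunction.mul_apply,
    ArithmeticFunction.mul_apply, Finset.mul_sum, ← Finset.sum_add_distrib]
  refine Finset.sum_congr rfl fun x hx ↦ ?_
  obtain ⟨hx, hn⟩ := Nat.mem_divisorsAntidiagonal.1 hx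
  have h1 : (x.1 : ℝ) ≠ 0 := by rintro h; simp_all
  have h2 : (x.2 : ℝ) ≠ 0 := by rintro h; simp_all
  rw [← hf, ← hg, ← hx, Nat.cast_mul, Real.log_mul h1 h2, Complex.ofReal_add]
  ring

theorem eq_of_log_mul_apply (hl : l 1 = 0) (hf : ∀ n : ℕ, Real.log n * f n = (f * l) n)
    (hg : ∀ n : ℕ, Real.log n * g n = (g * l) n) (h1 : f 1 = g 1) : f = g := by
  ext n
  induction n using Nat.strong_induction_on with
  | _ n ih =>
  rcases eq_or_ne n 0 with rfl | hn0
  · simp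
  rcases eq_or_ne n 1 with rfl | hn1
  · exact h1
  have hlog : (Real.log n : ℂ) ≠ 0 := by
    rw [Complex.ofReal_ne_zero]
    exact (Real.log_pos (by exact_mod_cast (by omega : 1 < n))).ne'
  refine mul_left_cancel₀ hlog ?_
  rw [hf, hg, ArithmeticFunction.mul_apply, ArithmeticFunction.mul_apply]
  refine Finset.sum_congr rfl fun x hx ↦ ?_
  obtain ⟨hx, hn⟩ := Nat.mem_divisorsAntidiagonal.1 hx
  rcases eq_or_ne x.2 1 with h2 | h2
  · rw [h2, hl, mul_zero, mul_zero]
  · rw [ih x.1 ?_]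
    have h3 : x.1 ≠ 0 := by rintro h; simp_all
    have h4 : x.2 ≠ 0 := by rintro h; simp_all
    rw [← hx]
    exact lt_mul_of_one_lt_right (by omega) (by omega)
end

section
variable (M : Type*) [Field M] [NumberField M]

theorem idealVonMangoldt_one : idealVonMangoldt (𝓞 M) 1 = 0 := by
  have h := log_mul_idealCount (𝓞 M) 1
  rw [ArithmeticFunction.mul_apply] at h
  simpa [idealCount_one] using h.symm

theorem idealCount_eq_natCard {n : ℕ} (hn : n ≠ 0) :
    idealCount (𝓞 M) n = Nat.card {I : Ideal (𝓞 M) // Ideal.absNorm I = n} := by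
  rw [idealCount_apply _ hn, idealsOfNorm,
    ← Set.ncard_eq_toFinset_card _ (Ideal.finite_setOfPred_absNorm_eq n)]
  rfl

theorem dedekindZeta_eq_LSeries (s : ℂ) :
    dedekindZeta M s = LSeries (idealCount (𝓞 M)) s :=
  (LSeries_congr (fun {_} hn ↦ idealCount_eq_natCard M hn) s).symm

theorem eventually_LSeriesSummable_idealCount :
    ∀ᶠ s : ℝ in nhdsWithin 1 (Set.Ioi 1), LSeriesSummable (idealCount (𝓞 M)) s := by
  have h0 : ((dedekindZeta_residue M : ℝ) : ℂ) ≠ 0 :=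
    Complex.ofReal_ne_zero.2 (dedekindZeta_residue_ne_zero M)
  filter_upwards [(tendsto_sub_one_mul_dedekindZeta_nhdsGT M).eventually_ne h0] with s hs
  by_contra h
  rw [dedekindZeta_eq_LSeries, LSeries, tsum_eq_zero_of_not_summable h, mul_zero] at hs
  exact hs rfl
end

theorem dedekindZeta_residue_mul_eq_of_idealVonMangoldt {F K L k : Type*} [Field F]
    [NumberField F] [Field K] [NumberField K] [Field L] [NumberField L] [Field k] [NumberField k]
    (h : ∀ n, idealVonMangoldt (𝓞 F) n + 2 * idealVonMangoldt (𝓞 K) n =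
      idealVonMangoldt (𝓞 L) n + 2 * idealVonMangoldt (𝓞 k) n) :
    dedekindZeta_residue F * dedekindZeta_residue K ^ 2 =
      dedekindZeta_residue L * dedekindZeta_residue k ^ 2 := by
  have hFK := log_mul_mul_apply (log_mul_idealCount (𝓞 F))
    (log_mul_mul_apply (log_mul_idealCount (𝓞 K)) (log_mul_idealCount (𝓞 K)))
  have hLk := log_mul_mul_apply (log_mul_idealCount (𝓞 L))
    (log_mul_mul_apply (log_mul_idealCount (𝓞 k)) (log_mul_idealCount (𝓞 k)))
  have hl : idealVonMangoldt (𝓞 L) + (idealVonMangoldt (𝓞 k) + idealVonMangoldt (𝓞 k)) =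
      idealVonMangoldt (𝓞 F) + (idealVonMangoldt (𝓞 K) + idealVonMangoldt (𝓞 K)) := by
    ext n
    simpa [two_mul] using (h n).symm
  rw [hl] at hLk
  have heq := eq_of_log_mul_apply (by simp [idealVonMangoldt_one]) hFK hLk
    (by simp [idealCount_one])
  have key : (fun s : ℝ ↦ (s - 1) * dedekindZeta F s * ((s - 1) * dedekindZeta K s) ^ 2) =ᶠ[
      nhdsWithin 1 (Set.Ioi 1)]
      fun s : ℝ ↦ (s - 1) * dedekindZeta L s * ((s - 1) * dedekindZeta k s) ^ 2 := by
    filter_upwards [eventually_LSeriesSummable_idealCount F,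
      eventually_LSeriesSummable_idealCount K, eventually_LSeriesSummable_idealCount L,
      eventually_LSeriesSummable_idealCount k] with s hF hK hL hk
    have hζ := congr_arg (fun f : ArithmeticFunction ℂ ↦ LSeries f s) heq
    rw [ArithmeticFunction.LSeries_mul' hF (ArithmeticFunction.LSeriesSummable_mul hK hK),
      ArithmeticFunction.LSeries_mul' hL (ArithmeticFunction.LSeriesSummable_mul hk hk),
      ArithmeticFunction.LSeries_mul' hK hK, ArithmeticFunction.LSeries_mul' hk hk] at hζ
    simp only [dedekindZeta_eq_LSeries]
    linear_combination ((s : ℂ) - 1) ^ 3 * hζ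
  have hlim := tendsto_nhds_unique_of_eventuallyEq
    ((tendsto_sub_one_mul_dedekindZeta_nhdsGT F).mul
      ((tendsto_sub_one_mul_dedekindZeta_nhdsGT K).pow 2))
    ((tendsto_sub_one_mul_dedekindZeta_nhdsGT L).mul
      ((tendsto_sub_one_mul_dedekindZeta_nhdsGT k).pow 2)) key
  exact_mod_cast hlim

section
variable {p : ℕ} [hp : Fact p.Prime] {Ω : Type*} [Field Ω] [CharP Ω p]

theorem card_ringHom_iterateFrobenius_comp_eq [IsAlgClosed Ω] {κ : Type*} [Field κ] [CharP κ p]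
    {f : ℕ} (hf : Nat.card κ = p ^ f) (n : ℕ) :
    Nat.card {z : κ →+* Ω // (iterateFrobenius Ω p n).comp z = z} = if f ∣ n then f else 0 := by
  have : Finite κ := Nat.finite_of_card_ne_zero (hf ▸ pow_ne_zero _ hp.out.ne_zero)
  let _ : Algebra (ZMod p) κ := ZMod.algebra κ p
  let _ : Algebra (ZMod p) Ω := ZMod.algebra Ω p
  have hfin : Module.finrank (ZMod p) κ = f := by
    rw [Module.natCard_eq_pow_finrank (K := ZMod p), Nat.card_zmod] at hf
    exact Nat.pow_right_injective hp.out.two_le hf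
  have hfix (z : κ →+* Ω) : (iterateFrobenius Ω p n).comp z = z ↔ f ∣ n := by
    rw [← hfin, ← FiniteField.orderOf_frobeniusAlgHom, orderOf_dvd_iff_pow_eq_one,
      RingHom.ext_iff, AlgHom.ext_iff]
    refine forall_congr' fun x ↦ ?_
    rw [RingHom.comp_apply, iterateFrobenius_def, ← map_pow, z.injective.eq_iff]
    rw [AlgHom.coe_pow, FiniteField.coe_frobeniusAlgHom, pow_iterate, ZMod.card, AlgHom.one_apply]
  split_ifs with h
  · rw [Nat.card_congr (Equiv.subtypeUnivEquiv fun z ↦ (hfix z).2 h),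
      ← hfin, ← AlgHom.card (ZMod p) κ Ω, ← Nat.card_eq_fintype_card]
    exact Nat.card_congr
      { toFun := fun z ↦ AlgHom.mk z fun r ↦ RingHom.congr_fun
          (RingHom.ext_zmod (z.comp (algebraMap (ZMod p) κ)) (algebraMap (ZMod p) Ω)) r
        invFun := fun z ↦ z
        left_inv := fun _ ↦ rfl
        right_inv := fun _ ↦ rfl }
  · rw [Nat.card_eq_zero]
    exact .inl ⟨fun z ↦ h ((hfix z.1).1 z.2)⟩

theorem card_ringHom_ker_eq {B : Type*} [CommRing B] (P : Ideal B) [hP : P.IsMaximal]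
    (φ : Ω →+* Ω) :
    Nat.card {y : B →+* Ω // φ.comp y = y ∧ RingHom.ker y = P} =
      Nat.card {z : B ⧸ P →+* Ω // φ.comp z = z} := by
  let _ := Ideal.Quotient.field P
  refine (Nat.card_congr (Equiv.ofBijective
    (fun z : {z : B ⧸ P →+* Ω // φ.comp z = z} ↦ (⟨z.1.comp (Ideal.Quotient.mk P), ?_, ?_⟩ :
      {y : B →+* Ω // φ.comp y = y ∧ RingHom.ker y = P})) ⟨?_, ?_⟩)).symm
  · rw [← RingHom.comp_assoc, z.2]
  · rw [← RingHom.comap_ker, (RingHom.injective_iff_ker_eq_bot z.1).1 z.1.injective,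
      ← RingHom.ker_eq_comap_bot, Ideal.mk_ker]
  · exact fun z w h ↦ Subtype.ext (Ideal.Quotient.ringHom_ext (congr_arg Subtype.val h))
  · rintro ⟨y, hy, rfl⟩
    refine ⟨⟨RingHom.kerLift y, ?_⟩, Subtype.ext (RingHom.ext fun b ↦ rfl)⟩
    refine Ideal.Quotient.ringHom_ext (RingHom.ext fun b ↦ ?_)
    exact RingHom.congr_fun hy b

theorem idealVonMangoldt_prime_pow [IsAlgClosed Ω] (B : Type*) [CommRing B] [IsDedekindDomain B]
    [Module.Free ℤ B] [Module.Finite ℤ B] [CharZero B] {n : ℕ} (hn : n ≠ 0) :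
    idealVonMangoldt B (p ^ n) = Real.log p *
      Nat.card {y : B →+* Ω // (iterateFrobenius Ω p n).comp y = y} := by
  classical
  let φ := iterateFrobenius Ω p n
  have hfin : Finite (B →+* Ω) := finite_ringHom_of_moduleFinite B Ω
  have hpΩ (m : ℕ) : (m : Ω) = 0 ↔ p ∣ m := CharP.cast_eq_zero_iff Ω p m
  have hmax (P : Ideal B) (hP : Prime P) : P.IsMaximal :=
    (Ideal.isPrime_of_prime hP).isMaximal hP.ne_zero
  have hker (y : B →+* Ω) : Prime (RingHom.ker y) := by
    refine Ideal.prime_of_isPrime (fun h ↦ ?_) (RingHom.ker_isPrime y)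
    have : (p : B) ∈ RingHom.ker y := by
      rw [RingHom.mem_ker, map_natCast, hpΩ]
    rw [h, Ideal.mem_bot, Nat.cast_eq_zero] at this
    exact hp.out.ne_zero this
  have hval (P : Ideal B) (hP : Prime P) : ∑ m ∈ Finset.Icc 1 (p ^ n),
        (if Ideal.absNorm P ^ m = p ^ n then (Real.log (Ideal.absNorm P) : ℂ) else 0) =
      Real.log p * Nat.card {y : B →+* Ω // φ.comp y = y ∧ RingHom.ker y = P} := by
    have := hmax P hP
    obtain ⟨r, f, hf, hrP, hr, hnorm⟩ := Ideal.exists_prime_and_absNorm_eq_pow P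
    simp only [hnorm, ← pow_mul]
    by_cases hrp : r = p
    · subst hrp
      let _ := Ideal.Quotient.field P
      have : CharP (B ⧸ P) r := (CharP.charP_iff_prime_eq_zero hr).2
        ((map_natCast (Ideal.Quotient.mk P) r).symm.trans (Ideal.Quotient.eq_zero_iff_mem.2 hrP))
      rw [card_ringHom_ker_eq, card_ringHom_iterateFrobenius_comp_eq (κ := B ⧸ P) hnorm]
      simp only [(Nat.pow_right_injective hr.two_le).eq_iff]
      split_ifs with hfn
      · obtain ⟨m, rfl⟩ := hfn
        have hm : m ≠ 0 := right_ne_zero_of_mul hn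
        rw [Finset.sum_eq_single m, if_pos rfl, Nat.cast_pow, Real.log_pow]
        · push_cast
          ring
        · exact fun m' _ hm' ↦ if_neg fun h ↦ hm' (Nat.eq_of_mul_eq_mul_left hf h)
        · refine fun h ↦ (h (Finset.mem_Icc.2 ⟨Nat.one_le_iff_ne_zero.2 hm, ?_⟩)).elim
          exact (Nat.le_mul_of_pos_left m hf).trans (Nat.lt_pow_self hr.one_lt).le
      · rw [Finset.sum_eq_zero fun m _ ↦ if_neg fun h ↦ hfn ⟨m, h.symm⟩, Nat.cast_zero, mul_zero]
    · have hempty : IsEmpty {y : B →+* Ω // φ.comp y = y ∧ RingHom.ker y = P} := by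
        refine ⟨fun ⟨y, _, hy⟩ ↦ hrp ?_⟩
        rw [← hy, RingHom.mem_ker, map_natCast, hpΩ] at hrP
        exact ((Nat.prime_dvd_prime_iff_eq hp.out hr).1 hrP).symm
      rw [Nat.card_of_isEmpty, Nat.cast_zero, mul_zero]
      refine Finset.sum_eq_zero fun m hm ↦ if_neg fun h ↦ hrp ?_
      have hm0 : f * m ≠ 0 := by
        have := (Finset.mem_Icc.1 hm).1
        positivity
      exact (Nat.prime_dvd_prime_iff_eq hr hp.out).1
        (hr.dvd_of_dvd_pow (h ▸ dvd_pow_self r hm0))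
  have hmem (y : B →+* Ω) (hy : φ.comp y = y) : RingHom.ker y ∈ primesOfNormLE B (p ^ n) := by
    refine mem_primesOfNormLE.2 ⟨?_, hker y⟩
    by_contra! h
    have h1 := hval _ (hker y)
    rw [Finset.sum_eq_zero, zero_eq_mul] at h1
    · have hlog : (Real.log p : ℂ) ≠ 0 :=
        Complex.ofReal_ne_zero.2 (Real.log_pos (by exact_mod_cast hp.out.one_lt)).ne'
      have : Nonempty {z : B →+* Ω // φ.comp z = z ∧ RingHom.ker z = RingHom.ker y} :=
        ⟨⟨y, hy, rfl⟩⟩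
      exact Nat.card_pos.ne' (Nat.cast_eq_zero.1 (h1.resolve_left hlog))
    · refine fun m hm ↦ if_neg fun hpow ↦ h.not_ge ?_
      rw [← hpow]
      exact Nat.le_self_pow (Nat.one_le_iff_ne_zero.1 (Finset.mem_Icc.1 hm).1) _
  have hcard : Nat.card {y : B →+* Ω // φ.comp y = y} = ∑ P ∈ primesOfNormLE B (p ^ n),
      Nat.card {y : B →+* Ω // φ.comp y = y ∧ RingHom.ker y = P} := by
    cases nonempty_fintype (B →+* Ω)
    simp only [Nat.card_eq_fintype_card, Fintype.card_subtype, ← Finset.filter_filter]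
    exact Finset.card_eq_sum_card_fiberwise fun y hy ↦ hmem y (Finset.mem_filter.1 hy).2
  rw [hcard, Nat.cast_sum, Finset.mul_sum]
  exact Finset.sum_congr rfl fun P hP ↦ hval P (mem_primesOfNormLE.1 hP).2

theorem idealVonMangoldt_eq_zero (B : Type*) [CommRing B] [IsDedekindDomain B]
    [Module.Free ℤ B] [Module.Finite ℤ B] [CharZero B] {n : ℕ} (hn : ¬IsPrimePow n) :
    idealVonMangoldt B n = 0 := by
  refine Finset.sum_eq_zero fun P hP ↦ Finset.sum_eq_zero fun m hm ↦ if_neg fun h ↦ hn ?_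
  have hP := (mem_primesOfNormLE.1 hP).2
  have : P.IsMaximal := (Ideal.isPrime_of_prime hP).isMaximal hP.ne_zero
  obtain ⟨r, f, hf, -, hr, hnorm⟩ := Ideal.exists_prime_and_absNorm_eq_pow P
  rw [← h, hnorm, ← pow_mul]
  exact hr.isPrimePow.pow (mul_ne_zero hf.ne' (Nat.one_le_iff_ne_zero.1 (Finset.mem_Icc.1 hm).1))
end

theorem dihedral_idealVonMangoldt {q : ℕ} [NeZero q] (hq : Odd q)
    {K F : Type*} [Field K] [NumberField K] [Field F] [NumberField F]
    [Algebra K F] [IsGalois K F] (e : (F ≃ₐ[K] F) ≃* DihedralGroup q)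
    (L k : IntermediateField K F) [NumberField L] [NumberField k]
    (hL : L = IntermediateField.fixedField
      ((Subgroup.zpowers (DihedralGroup.r (1 : ZMod q))).comap e.toMonoidHom))
    (hk : k = IntermediateField.fixedField
      ((Subgroup.zpowers (DihedralGroup.sr (0 : ZMod q))).comap e.toMonoidHom)) (n : ℕ) :
    idealVonMangoldt (𝓞 F) n + 2 * idealVonMangoldt (𝓞 K) n =
      idealVonMangoldt (𝓞 L) n + 2 * idealVonMangoldt (𝓞 k) n := by
  by_cases hn : IsPrimePow n
  · obtain ⟨p, m, hp, hm, rfl⟩ := hn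
    have : Fact p.Prime := ⟨hp.nat_prime⟩
    let Ω := AlgebraicClosure (ZMod p)
    have : CharP Ω p := charP_of_injective_algebraMap (algebraMap (ZMod p) Ω).injective p
    have h := congr_arg (Nat.cast : ℕ → ℂ)
      (dihedral_natCard_ringOfIntegers hq e L k hL hk (iterateFrobenius Ω p m))
    push_cast at h
    simp only [idealVonMangoldt_prime_pow (p := p) (Ω := Ω) _ hm.ne']
    linear_combination (Real.log p : ℂ) * h
  · simp only [idealVonMangoldt_eq_zero _ hn, mul_zero, add_zero]

theorem dihedral_classNumber_mul_regulator {q : ℕ} [NeZero q] (hq : Odd q)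
    {K F : Type*} [Field K] [NumberField K] [Field F] [NumberField F]
    [Algebra K F] [IsGalois K F] (e : (F ≃ₐ[K] F) ≃* DihedralGroup q)
    (L k : IntermediateField K F) [NumberField L] [NumberField k]
    (hL : L = IntermediateField.fixedField
      ((Subgroup.zpowers (DihedralGroup.r (1 : ZMod q))).comap e.toMonoidHom))
    (hk : k = IntermediateField.fixedField
      ((Subgroup.zpowers (DihedralGroup.sr (0 : ZMod q))).comap e.toMonoidHom)) :
    regulator F * classNumber F * (regulator K * classNumber K) ^ 2 =
      regulator L * classNumber L * (regulator k * classNumber k) ^ 2 := by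
  have hres := dedekindZeta_residue_mul_eq_of_idealVonMangoldt
    (dihedral_idealVonMangoldt hq e L k hL hk)
  have hwL := dihedral_torsionOrder_rotation hq e L hL
  have hwK := dihedral_torsionOrder_reflection hq e k hk
  have hr1 := dihedral_nrRealPlaces hq e L k hL hk
  have hr2 := dihedral_nrComplexPlaces hq e L k hL hk
  have hd := dihedral_discr hq e L k hL hk
  have hpow (x : ℝ) {a b c d : ℕ} (h : a + 2 * b = c + 2 * d) :
      x ^ a * (x ^ b) ^ 2 = x ^ c * (x ^ d) ^ 2 := by
    rw [← pow_mul, ← pow_mul, ← pow_add, ← pow_add, mul_comm b, mul_comm d, h]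
  have hsqrt : √((discr F).natAbs : ℝ) * √((discr K).natAbs : ℝ) ^ 2 =
      √((discr L).natAbs : ℝ) * √((discr k).natAbs : ℝ) ^ 2 := by
    have := congr_arg (fun n : ℕ ↦ √(n : ℝ)) hd
    simp only [Nat.cast_mul, Nat.cast_pow] at this
    rwa [Real.sqrt_mul (Nat.cast_nonneg _), Real.sqrt_mul (Nat.cast_nonneg _),
      Real.sqrt_sq (Nat.cast_nonneg _), Real.sqrt_sq (Nat.cast_nonneg _),
      ← Real.sq_sqrt (Nat.cast_nonneg (discr K).natAbs),
      ← Real.sq_sqrt (Nat.cast_nonneg (discr k).natAbs)] at this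
  have habs (x : ℤ) : |(x : ℝ)| = (x.natAbs : ℝ) := by rw [Nat.cast_natAbs, Int.cast_abs]
  simp only [dedekindZeta_residue_def, habs, hwL, ← hwK] at hres
  have h1 := hpow 2 hr1
  have h2 := hpow (2 * Real.pi) hr2
  have hwF : (torsionOrder F : ℝ) ≠ 0 := Nat.cast_ne_zero.2 (torsionOrder_pos F).ne'
  have hwK : (torsionOrder K : ℝ) ≠ 0 := Nat.cast_ne_zero.2 (torsionOrder_pos K).ne'
  have hdL := (Real.sqrt_pos.2 (natAbs_discr_pos L)).ne'
  have hdk := (Real.sqrt_pos.2 (natAbs_discr_pos k)).ne'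
  rw [div_pow, div_pow, div_mul_div_comm, div_mul_div_comm] at hres
  have hden : (torsionOrder F * √((discr F).natAbs : ℝ)) *
      (torsionOrder K * √((discr K).natAbs : ℝ)) ^ 2 =
      (torsionOrder F * √((discr L).natAbs : ℝ)) *
      (torsionOrder K * √((discr k).natAbs : ℝ)) ^ 2 := by
    linear_combination (torsionOrder F : ℝ) * (torsionOrder K : ℝ) ^ 2 * hsqrt
  rw [hden, div_left_inj' (by positivity)] at hres
  have hne : (2 : ℝ) ^ InfinitePlace.nrRealPlaces L * (2 ^ InfinitePlace.nrRealPlaces k) ^ 2 *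
      ((2 * Real.pi) ^ InfinitePlace.nrComplexPlaces L *
        ((2 * Real.pi) ^ InfinitePlace.nrComplexPlaces k) ^ 2) ≠ 0 := by
    positivity
  refine mul_left_cancel₀ hne ?_
  calc _ = (2 : ℝ) ^ InfinitePlace.nrRealPlaces F * (2 ^ InfinitePlace.nrRealPlaces K) ^ 2 *
      ((2 * Real.pi) ^ InfinitePlace.nrComplexPlaces F *
        ((2 * Real.pi) ^ InfinitePlace.nrComplexPlaces K) ^ 2) *
      (regulator F * classNumber F * (regulator K * classNumber K) ^ 2) := by rw [h1, h2]
    _ = _ := by linear_combination hres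

/-- Let `F/K` be a dihedral extension of number fields of degree `2q`, `q` odd,
with `L` and `k` the subfields fixed by the rotation subgroup and by an order-2
subgroup respectively.  Then `h_F = h_L · (h_k/h_K)² · (R_k² R_L)/(R_K² R_F)`,
i.e. `h_F h_K² R_K² R_F = h_L h_k² R_k² R_L`; in particular the ratio
`(R_k² R_L)/(R_K² R_F)` of regulators is a rational number. -/
theorem classNumber_dihedral_formula (q : ℕ) [NeZero q] (hq : Odd q) (hq1 : 1 < q)
    (K F : Type*) [Field K] [NumberField K] [Field F] [NumberField F]
    [Algebra K F] [IsGalois K F]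
    (e : (F ≃ₐ[K] F) ≃* DihedralGroup q)
    (Lf kf : IntermediateField K F) [NumberField Lf] [NumberField kf]
    (hL : Lf = IntermediateField.fixedField
      ((Subgroup.zpowers (DihedralGroup.r (1 : ZMod q))).comap e.toMonoidHom))
    (hk : kf = IntermediateField.fixedField
      ((Subgroup.zpowers (DihedralGroup.sr (0 : ZMod q))).comap e.toMonoidHom)) :
    (classNumber F : ℝ) * (classNumber K : ℝ) ^ 2 *
        (regulator K ^ 2 * regulator F)
      = (classNumber Lf : ℝ) * (classNumber kf : ℝ) ^ 2 *
        (regulator kf ^ 2 * regulator Lf) ∧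
    ∃ r : ℚ, (regulator kf ^ 2 * regulator Lf) / (regulator K ^ 2 * regulator F)
      = (r : ℝ) := by
  have h := dihedral_classNumber_mul_regulator hq e Lf kf hL hk
  have h' : (classNumber F : ℝ) * (classNumber K : ℝ) ^ 2 * (regulator K ^ 2 * regulator F) =
      (classNumber Lf : ℝ) * (classNumber kf : ℝ) ^ 2 * (regulator kf ^ 2 * regulator Lf) := by
    linear_combination h
  refine ⟨h', classNumber F * classNumber K ^ 2 / (classNumber Lf * classNumber kf ^ 2), ?_⟩
  have hRK := regulator_pos K
  have hRF := regulator_pos F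
  have hhL : (0 : ℝ) < classNumber Lf := Nat.cast_pos.2 (classNumber_pos Lf)
  have hhk : (0 : ℝ) < classNumber kf := Nat.cast_pos.2 (classNumber_pos kf)
  push_cast
  rw [div_eq_div_iff (by positivity) (by positivity)]
  linear_combination -h'
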